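/- arXiv:1611.04034 — 10 statements merged into one kernel-verified Lean document; each statement's English description precedes it below -/
import Mathlib

section
/- Let c be an outcome of a public decision making instance with n players and m issues, and suppose there exist pairwise disjoint sets of issues S_1, …, S_n ⊆ T and, for each player i, an enumeration t_i(1), …, t_i(m) of T with u^{t_i(1)}_max(i) ≥ … ≥ u^{t_i(m)}_max(i), such that: (i) u_i^t(c_t) = u^t_max(i) for every t ∈ S_i, and (ii) for every k ∈ {1,…,p}, |S_i ∩ {t_i(1),…,t_i(k·n)}| ≥ k (these conditions hold for any outcome of the round robin mechanism). Then c satisfies RRS, i.e., u_i(c) ≥ RRS_i for every player i. -/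
open Finset

structure PubInst (n m : ℕ) where
  A : Fin m → Type
  fin : ∀ t, Fintype (A t)
  nonempty : ∀ t, Nonempty (A t)
  u : Fin n → (t : Fin m) → A t → ℝ
  nonneg : ∀ i t a, 0 ≤ u i t a

namespace PubInst

variable {n m : ℕ}

/-- An outcome chooses one alternative per issue. -/
def Outcome (I : PubInst n m) : Type := (t : Fin m) → I.A t

/-- Utility of player `i` under outcome `c`. -/
noncomputable def util (I : PubInst n m) (c : I.Outcome) (i : Fin n) : ℝ :=
  ∑ t : Fin m, I.u i t (c t)

/-- Maximum utility player `i` can derive from issue `t`. -/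
noncomputable def umax (I : PubInst n m) (i : Fin n) (t : Fin m) : ℝ :=
  letI := I.fin t
  Finset.univ.sup' (Finset.univ_nonempty_iff.mpr (I.nonempty t)) (I.u i t)

/-- Values of `f` sorted in non-increasing order: `sortedDesc f r` is the `(r+1)`-th largest. -/
noncomputable def sortedDesc (f : Fin m → ℝ) : Fin m → ℝ :=
  fun r => f (Tuple.sort (fun j => -f j) r)

noncomputable def propShare (I : PubInst n m) (i : Fin n) : ℝ :=
  (1 / (n : ℝ)) * ∑ t : Fin m, I.umax i t

noncomputable def RRS (I : PubInst n m) (i : Fin n) : ℝ :=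
  ∑ r : Fin m,
    if n ∣ (r.val + 1) ∧ r.val + 1 ≤ (m / n) * n then sortedDesc (I.umax i) r else 0

noncomputable def PPS (I : PubInst n m) (i : Fin n) : ℝ :=
  ∑ r : Fin m, if m - m / n ≤ r.val then sortedDesc (I.umax i) r else 0

def ParetoOptimal (I : PubInst n m) (c : I.Outcome) : Prop :=
  ¬ ∃ c' : I.Outcome, (∀ i, I.util c i ≤ I.util c' i) ∧ ∃ j, I.util c j < I.util c' j

def MNW (I : PubInst n m) (c : I.Outcome) : Prop :=
  (∀ c' : I.Outcome,
      (Finset.univ.filter fun i => 0 < I.util c' i).card ≤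
        (Finset.univ.filter fun i => 0 < I.util c i).card) ∧
  (∀ c' : I.Outcome,
      (∏ i ∈ Finset.univ.filter fun i => 0 < I.util c i, I.util c' i) ≤
        ∏ i ∈ Finset.univ.filter fun i => 0 < I.util c i, I.util c i)

end PubInst

/-- If `r ↦ g r` is non-increasing and every initial segment ending in `R` contains at least as
many elements of `P` as of `R`, then the sum of `g` over `R` is at most its sum over `P`. -/
theorem Antitone.sum_le_sum_of_card_filter_le {α : Type*} [LinearOrder α] {g : α → ℝ}
    (hg : Antitone g) (hg0 : ∀ a, 0 ≤ g a) (R P : Finset α)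
    (hcard : ∀ r ∈ R, (R.filter (· ≤ r)).card ≤ (P.filter (· ≤ r)).card) :
    ∑ r ∈ R, g r ≤ ∑ r ∈ P, g r := by
  obtain ⟨φ, hφ, hmem⟩ :=
    (Finset.all_card_le_biUnion_card_iff_exists_injective
      (fun r : R => P.filter (· ≤ (r : α)))).mp (by
        intro s
        rcases s.eq_empty_or_nonempty with rfl | hs
        · simp
        · set M := s.max' hs
          have hM : M ∈ s := s.max'_mem hs
          calc s.card = (s.map (Function.Embedding.subtype _)).card := (card_map _).symm
            _ ≤ (R.filter (· ≤ (M : α))).card := by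
                refine card_le_card fun x hx => ?_
                obtain ⟨y, hy, rfl⟩ := mem_map.mp hx
                exact mem_filter.mpr ⟨y.2, s.le_max' y hy⟩
            _ ≤ (P.filter (· ≤ (M : α))).card := hcard M M.2
            _ ≤ _ := card_le_card (subset_biUnion_of_mem (fun r : R => P.filter (· ≤ (r : α))) hM))
  simp only [mem_filter] at hmem
  calc ∑ r ∈ R, g r = ∑ r : R, g r := (sum_coe_sort R g).symm
    _ ≤ ∑ r : R, g (φ r) := sum_le_sum fun r _ => hg (hmem r).2
    _ = ∑ a ∈ univ.map ⟨φ, hφ⟩, g a := (sum_map univ ⟨φ, hφ⟩ g).symm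
    _ ≤ ∑ r ∈ P, g r := by
        refine sum_le_sum_of_subset_of_nonneg (fun x hx => ?_) fun a _ _ => hg0 a
        obtain ⟨y, -, rfl⟩ := mem_map.mp hx
        exact (hmem y).1

namespace PubInst

theorem sortedDesc_eq_of_antitone {m : ℕ} {f : Fin m → ℝ} {σ : Equiv.Perm (Fin m)}
    (hσ : Antitone fun r => f (σ r)) (r : Fin m) : sortedDesc f r = f (σ r) := by
  have h := (Tuple.comp_sort_eq_comp_iff_monotone (f := fun j => -f j) (σ := σ)).mpr
    fun a b hab => neg_le_neg (hσ hab)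
  exact (neg_injective (congrFun h r)).symm

theorem umax_nonneg {n m : ℕ} (I : PubInst n m) (i : Fin n) (t : Fin m) : 0 ≤ I.umax i t := by
  let := I.fin t
  obtain ⟨a⟩ := I.nonempty t
  exact (I.nonneg i t a).trans (le_sup' (I.u i t) (mem_univ a))

end PubInst

/-- Among the `r < K * n` at most `K` satisfy `n ∣ r + 1`. -/
theorem Fin.card_filter_dvd_succ_le {m n : ℕ} (hn : 1 ≤ n) (K : ℕ) :
    (univ.filter fun r : Fin m => n ∣ r.val + 1 ∧ r.val < K * n).card ≤ K := by
  calc _ ≤ (Finset.Icc 1 K).card := by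
        refine card_le_card_of_injOn (fun r => (r.val + 1) / n) (fun r hr => ?_) ?_
        · obtain ⟨⟨d, hd⟩, hlt⟩ := (mem_filter.mp hr).2
          have hdK : d ≤ K := by
            by_contra! h
            nlinarith
          have hd1 : 1 ≤ d := by
            rcases d.eq_zero_or_pos with rfl | h
            · simp at hd
            · exact h
          simp only [hd, Nat.mul_div_cancel_left d hn]
          exact mem_coe.mpr (mem_Icc.mpr ⟨hd1, hdK⟩)
        · intro a ha b hb hab
          have h := (Nat.div_left_inj (mem_filter.mp ha).2.1 (mem_filter.mp hb).2.1).mp hab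
          exact Fin.ext (by omega)
    _ = K := by simp

/-- If outcome `c` agrees with player `i`'s favorite alternative on the
pairwise disjoint sets `S i`, and each `S i` contains at least `k` of player `i`'s top `k·n`
issues for every `k ∈ {1,…,⌊m/n⌋}` (as holds for any round robin outcome), then `c`
satisfies the round robin share: `u_i(c) ≥ RRS_i` for every player `i`. -/
theorem roundRobin_satisfies_RRS {n m : ℕ} (hn : 1 ≤ n) (I : PubInst n m) (c : I.Outcome)
    (S : Fin n → Finset (Fin m))
    (hdisj : ∀ i j : Fin n, i ≠ j → Disjoint (S i) (S j))
    (e : Fin n → Equiv.Perm (Fin m))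
    (he : ∀ i : Fin n, Antitone (fun r : Fin m => I.umax i (e i r)))
    (hfav : ∀ i : Fin n, ∀ t ∈ S i, I.u i t (c t) = I.umax i t)
    (htop : ∀ i : Fin n, ∀ K : ℕ, 1 ≤ K → K ≤ m / n →
      K ≤ (Finset.univ.filter fun r : Fin m => r.val < K * n ∧ e i r ∈ S i).card) :
    ∀ i : Fin n, I.RRS i ≤ I.util c i := by
  intro i
  set R : Finset (Fin m) := univ.filter fun r => n ∣ r.val + 1 ∧ r.val + 1 ≤ m / n * n
  set P : Finset (Fin m) := univ.filter fun r => e i r ∈ S i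
  have hcard : ∀ r ∈ R, (R.filter (· ≤ r)).card ≤ (P.filter (· ≤ r)).card := by
    intro r hr
    obtain ⟨⟨K, hK⟩, hle⟩ := (mem_filter.mp hr).2
    rw [mul_comm] at hK
    have hK1 : 1 ≤ K := by
      rcases K.eq_zero_or_pos with rfl | h
      · simp at hK
      · exact h
    have hKp : K ≤ m / n := Nat.le_of_mul_le_mul_right (hK ▸ hle) hn
    calc _ ≤ (univ.filter fun q : Fin m => n ∣ q.val + 1 ∧ q.val < K * n).card := by
          refine card_le_card fun q hq => ?_
          simp only [R, mem_filter, mem_univ, true_and, Fin.le_def] at hq ⊢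
          exact ⟨hq.1.1, by omega⟩
      _ ≤ K := Fin.card_filter_dvd_succ_le hn K
      _ ≤ _ := htop i K hK1 hKp
      _ ≤ _ := by
          refine card_le_card fun q hq => ?_
          simp only [P, mem_filter, mem_univ, true_and, Fin.le_def] at hq ⊢
          exact ⟨hq.2, by omega⟩
  calc I.RRS i = ∑ r ∈ R, I.umax i (e i r) := by
        simp only [PubInst.RRS, PubInst.sortedDesc_eq_of_antitone (he i), R, sum_filter]
    _ ≤ ∑ r ∈ P, I.umax i (e i r) :=
        (he i).sum_le_sum_of_card_filter_le (fun _ => I.umax_nonneg i _) R P hcard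
    _ = ∑ t ∈ S i, I.umax i t :=
        sum_equiv (e i) (by simp [P]) fun _ _ => rfl
    _ = ∑ t ∈ S i, I.u i t (c t) := sum_congr rfl fun t ht => (hfav i t ht).symm
    _ ≤ I.util c i :=
        sum_le_sum_of_subset_of_nonneg (subset_univ _) fun t _ _ => I.nonneg i t (c t)
end

section
/- In any private goods division instance, every allocation satisfying EF1 (envy-freeness up to one good) also satisfies Prop1 (proportionality up to one good): for every player i, either u_i(A_i) ≥ Prop_i, or there exists a good g ∉ A_i with u_i(A_i ∪ {g}) ≥ Prop_i. -/
open Finset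

-- A private goods division instance with `n` players and `m` goods: the goods are
-- `Fin m`, player `i` values good `g` at `u i g`, and an allocation is a function
-- `A : Fin m → Fin n` assigning each good to a player (a partition of the goods).

/-- Value of player `i` for the bundle allocated to player `j` under allocation `A`. -/
noncomputable def bundleVal {n m : ℕ} (u : Fin n → Fin m → ℝ) (A : Fin m → Fin n)
    (i j : Fin n) : ℝ :=
  ∑ g : Fin m, if A g = j then u i g else 0

/-- Envy-freeness up to one good: every player `i` either does not envy `j`, or does not
envy `j` after removing some single good from `j`'s bundle. -/
def EF1 {n m : ℕ} (u : Fin n → Fin m → ℝ) (A : Fin m → Fin n) : Prop :=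
  ∀ i j : Fin n,
    bundleVal u A i j ≤ bundleVal u A i i ∨
    ∃ g0 : Fin m, A g0 = j ∧
      (∑ g : Fin m, if A g = j ∧ g ≠ g0 then u i g else 0) ≤ bundleVal u A i i

/-- The proportional share of player `i`: a `1/n` fraction of her value for all goods. -/
noncomputable def propShare {n m : ℕ} (u : Fin n → Fin m → ℝ) (i : Fin n) : ℝ :=
  (∑ g : Fin m, u i g) / (n : ℝ)

/-- Values of `f` sorted in non-increasing order: `sortedDesc f r` is the `(r+1)`-th largest. -/
noncomputable def sortedDesc {m : ℕ} (f : Fin m → ℝ) : Fin m → ℝ :=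
  fun r => f (Tuple.sort (fun j => -f j) r)

/-- The round robin share of player `i`: the sum of her `(k·n)`-th largest values for
`k = 1, …, ⌊m/n⌋` (ranks are 1-indexed; rank `r+1` corresponds to index `r : Fin m`). -/
noncomputable def RRSshare {n m : ℕ} (u : Fin n → Fin m → ℝ) (i : Fin n) : ℝ :=
  ∑ r : Fin m,
    if n ∣ (r.val + 1) ∧ r.val + 1 ≤ (m / n) * n then sortedDesc (u i) r else 0

/-- The pessimistic proportional share of player `i`: the sum of her `⌊m/n⌋` smallest
values among all goods. -/
noncomputable def PPSshare {n m : ℕ} (u : Fin n → Fin m → ℝ) (i : Fin n) : ℝ :=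
  ∑ r : Fin m, if m - m / n ≤ r.val then sortedDesc (u i) r else 0

/-- Pareto optimality of an allocation. -/
def ParetoOptimalAlloc {n m : ℕ} (u : Fin n → Fin m → ℝ) (A : Fin m → Fin n) : Prop :=
  ¬ ∃ A' : Fin m → Fin n,
      (∀ i, bundleVal u A i i ≤ bundleVal u A' i i) ∧
      ∃ j, bundleVal u A j j < bundleVal u A' j j

/-- Maximum Nash welfare allocation: with `S` the set of players getting positive utility,
`S` has maximum possible cardinality, and the allocation maximizes the product of the
utilities of players in `S`. -/
def MNWalloc {n m : ℕ} (u : Fin n → Fin m → ℝ) (A : Fin m → Fin n) : Prop :=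
  (∀ A' : Fin m → Fin n,
      (Finset.univ.filter fun i => 0 < bundleVal u A' i i).card ≤
        (Finset.univ.filter fun i => 0 < bundleVal u A i i).card) ∧
  (∀ A' : Fin m → Fin n,
      (∏ i ∈ Finset.univ.filter fun i => 0 < bundleVal u A i i, bundleVal u A' i i) ≤
        ∏ i ∈ Finset.univ.filter fun i => 0 < bundleVal u A i i, bundleVal u A i i)

/-- Proportionality up to one good. -/
def Prop1alloc {n m : ℕ} (u : Fin n → Fin m → ℝ) (A : Fin m → Fin n) : Prop :=
  ∀ i : Fin n,
    propShare u i ≤ bundleVal u A i i ∨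
    ∃ g : Fin m, A g ≠ i ∧ propShare u i ≤ bundleVal u A i i + u i g

/-- A player's values for the bundles of all players add up to her value for all goods. -/
theorem sum_bundleVal {n m : ℕ} (u : Fin n → Fin m → ℝ) (A : Fin m → Fin n) (i : Fin n) :
    ∑ j, bundleVal u A i j = ∑ g, u i g := by
  unfold bundleVal
  rw [Finset.sum_comm]
  simp

/-- A bundle is worth the good `g₀` it contains plus what remains after removing `g₀`. -/
theorem bundleVal_eq_add_of_mem {n m : ℕ} (u : Fin n → Fin m → ℝ) (A : Fin m → Fin n)
    (i : Fin n) {j : Fin n} {g₀ : Fin m} (h : A g₀ = j) :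
    bundleVal u A i j = (∑ g, if A g = j ∧ g ≠ g₀ then u i g else 0) + u i g₀ := by
  have hsingle : u i g₀ = ∑ g, if g = g₀ then u i g else 0 := by simp
  rw [hsingle, ← Finset.sum_add_distrib]
  refine Finset.sum_congr rfl fun g _ => ?_
  by_cases hg : g = g₀ <;> simp [hg, h]

/-- For private goods division, every allocation satisfying EF1
(envy-freeness up to one good) also satisfies Prop1 (proportionality up to one good):
every player either attains her proportional share, or would attain it after adding a
single good not in her bundle. -/
theorem EF1_implies_Prop1 {n m : ℕ} (hn : 1 ≤ n) (u : Fin n → Fin m → ℝ)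
    (hu : ∀ i g, 0 ≤ u i g) (A : Fin m → Fin n) (hEF1 : EF1 u A) :
    Prop1alloc u A := by
  intro i
  by_contra! hcon
  obtain ⟨hown, hadd⟩ := hcon
  have hlt : ∀ j, bundleVal u A i j < propShare u i := by
    intro j
    by_cases hji : j = i
    · rwa [hji]
    rcases hEF1 i j with h | ⟨g₀, hg₀, h⟩
    · exact h.trans_lt hown
    · have hg := hadd g₀ (hg₀ ▸ hji)
      rw [bundleVal_eq_add_of_mem u A i hg₀]
      linarith
  have hsum : ∑ j, bundleVal u A i j < ∑ _j : Fin n, propShare u i :=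
    Finset.sum_lt_sum_of_nonempty ⟨i, Finset.mem_univ i⟩ fun j _ => hlt j
  have hn0 : (n : ℝ) ≠ 0 := Nat.cast_ne_zero.mpr (by omega)
  rw [sum_bundleVal, Finset.sum_const, Finset.card_univ, Fintype.card_fin, nsmul_eq_mul,
    propShare, mul_div_cancel₀ _ hn0] at hsum
  exact lt_irrefl _ hsum
end

section
/- Let A be an allocation in a private goods division instance satisfying EF1. Then for every player i, u_i(A_i) ≥ Prop_i − (1/n)·Σ_{t=1}^{n−1} u^(t)_max(i), where u^(t)_max(i) is the utility player i derives from her t-th most valued good; equivalently, u_i(A_i) ≥ (1/n)·Σ_{t=n}^{m} u^(t)_max(i). -/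
open Finset

theorem sortedDesc_antitone {m : ℕ} (f : Fin m → ℝ) : Antitone (sortedDesc f) := by
  intro r s hrs
  have h := Tuple.monotone_sort (fun j => -f j) hrs
  simpa [sortedDesc] using h

/-- The values of at most `k < m` goods sum to at most the `k` largest values. -/
theorem sum_le_sum_sortedDesc {m k : ℕ} (hk : k < m) (f : Fin m → ℝ) (hf : ∀ g, 0 ≤ f g)
    (S : Finset (Fin m)) (hS : S.card ≤ k) :
    ∑ g ∈ S, f g ≤ ∑ r : Fin m, if r.val + 1 ≤ k then sortedDesc f r else 0 := by
  classical
  set σ := Tuple.sort (fun j => -f j)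
  set c := sortedDesc f ⟨k, hk⟩
  have hc : 0 ≤ c := hf _
  have hcard : ((univ.filter fun r : Fin m => r.val + 1 ≤ k).card : ℝ) = k := by
    have h : (univ.filter fun r : Fin m => r.val + 1 ≤ k) = Finset.Iio ⟨k, hk⟩ := by
      ext r
      simp [Fin.lt_def]
    rw [h, Fin.card_Iio]
  have hexcess : ∑ g ∈ S, (f g - c) ≤
      ∑ r : Fin m, if r.val + 1 ≤ k then sortedDesc f r - c else 0 := by
    have hperm : ∑ g ∈ S, (f g - c) =
        ∑ r : Fin m, if σ r ∈ S then sortedDesc f r - c else 0 := by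
      refine Eq.trans ?_ (Equiv.sum_comp σ fun g => if g ∈ S then f g - c else 0).symm
      simp
    rw [hperm]
    refine Finset.sum_le_sum fun r _ => ?_
    by_cases hr : r.val + 1 ≤ k
    · have : c ≤ sortedDesc f r := sortedDesc_antitone f (Fin.le_def.2 (by simp; omega))
      split_ifs <;> linarith
    · have : sortedDesc f r ≤ c := sortedDesc_antitone f (Fin.le_def.2 (by simp; omega))
      split_ifs <;> linarith
  rw [← Finset.sum_filter] at hexcess ⊢
  simp only [Finset.sum_sub_distrib, Finset.sum_const, nsmul_eq_mul, hcard] at hexcess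
  have : (S.card : ℝ) * c ≤ k * c := by gcongr
  linarith

/-- Under EF1, the envy of `i` towards `j` is covered by at most one good of `j`. -/
theorem EF1.exists_cover {n m : ℕ} {u : Fin n → Fin m → ℝ} {A : Fin m → Fin n}
    (h : EF1 u A) (i j : Fin n) :
    ∃ T : Finset (Fin m), (∀ g ∈ T, A g = j) ∧ T.card ≤ (if j = i then 0 else 1) ∧
      bundleVal u A i j ≤ bundleVal u A i i + ∑ g ∈ T, u i g := by
  by_cases hji : j = i
  · exact ⟨∅, by simp [hji]⟩
  rcases h i j with h | ⟨g0, hg0, h⟩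
  · exact ⟨∅, by simp [h]⟩
  · refine ⟨{g0}, by simpa using hg0, by simp [hji], ?_⟩
    have hsplit : bundleVal u A i j =
        (∑ g : Fin m, if A g = j ∧ g ≠ g0 then u i g else 0) + u i g0 := by
      rw [bundleVal, ← Fintype.sum_ite_eq g0 (u i), ← Finset.sum_add_distrib]
      refine Finset.sum_congr rfl fun g _ => ?_
      by_cases hg : g = g0
      · simp [hg, hg0]
      · simp [hg, Ne.symm hg]
    rw [Finset.sum_singleton]
    linarith

/-- For private goods division with `m ≥ n` goods, if allocation `A`
satisfies EF1, then every player `i` receives at least her proportional share minus a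
`1/n` fraction of the sum of her `n - 1` largest values (equivalently, at least
`(1/n)·∑_{t=n}^{m} u^(t)_max(i)`). -/
theorem EF1_bundle_lower_bound {n m : ℕ} (hn : 1 ≤ n) (hm : n ≤ m)
    (u : Fin n → Fin m → ℝ) (hu : ∀ i g, 0 ≤ u i g) (A : Fin m → Fin n)
    (hEF1 : EF1 u A) :
    ∀ i : Fin n,
      propShare u i -
        (1 / (n : ℝ)) * ∑ r : Fin m, (if r.val + 1 ≤ n - 1 then sortedDesc (u i) r else 0) ≤
      bundleVal u A i i := by
  classical
  intro i
  choose T hTA hTcard hTval using hEF1.exists_cover i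
  have hcard : (univ.biUnion T).card ≤ n - 1 := by
    refine Finset.card_biUnion_le.trans ((Finset.sum_le_sum fun j _ => hTcard j).trans ?_)
    rw [← Finset.add_sum_erase univ _ (Finset.mem_univ i), if_pos rfl, zero_add,
      Finset.sum_congr rfl fun j hj => if_neg (Finset.ne_of_mem_erase hj)]
    simp
  have hdisj : Set.PairwiseDisjoint (↑(univ : Finset (Fin n))) T := by
    intro j _ k _ hjk
    exact Finset.disjoint_left.2 fun g hj hk => hjk ((hTA j g hj).symm.trans (hTA k g hk))
  have htop := sum_le_sum_sortedDesc (by omega) (u i) (hu i) _ hcard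
  rw [Finset.sum_biUnion hdisj] at htop
  have hsum := Finset.sum_le_sum fun j (_ : j ∈ univ) => hTval j
  rw [sum_bundleVal, Finset.sum_add_distrib, Finset.sum_const, Finset.card_univ,
    Fintype.card_fin, nsmul_eq_mul] at hsum
  have hn0 : (0 : ℝ) < n := by exact_mod_cast hn
  rw [propShare, one_div_mul_eq_div, ← sub_div, div_le_iff₀ hn0]
  linarith
end

section
/- In any private goods division instance, every allocation A satisfying EF1 (envy-freeness up to one good) satisfies both: (i) PPS, i.e., u_i(A_i) ≥ PPS_i for every player i, and (ii) (n/(2n−1))-RRS, i.e., u_i(A_i) ≥ (n/(2n−1))·RRS_i for every player i. -/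
open Finset

/-- Under `EF1`, at most `n - 1` goods can be discarded so that player `i` envies no bundle of
remaining goods. -/
theorem EF1.exists_envyFree_subset {n m : ℕ} {u : Fin n → Fin m → ℝ}
    (hu : ∀ i g, 0 ≤ u i g) {A : Fin m → Fin n} (hA : EF1 u A) (i : Fin n) :
    ∃ T : Finset (Fin m), m + 1 ≤ #T + n ∧
      ∀ j, ∑ g ∈ T with A g = j, u i g ≤ bundleVal u A i i := by
  have key : ∀ j, ∃ R : Finset (Fin m), #R ≤ (if j = i then 0 else 1) ∧
      ∑ g with A g = j ∧ g ∉ R, u i g ≤ bundleVal u A i i := by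
    intro j
    by_cases hj : bundleVal u A i j ≤ bundleVal u A i i
    · refine ⟨∅, by simp, ?_⟩
      simpa [bundleVal, sum_filter] using hj
    · have hji : j ≠ i := by rintro rfl; exact hj le_rfl
      obtain ⟨g, -, hg⟩ := (hA i j).resolve_left hj
      refine ⟨{g}, by simp [hji], ?_⟩
      simpa [sum_filter] using hg
  choose R hRcard hR using key
  refine ⟨(univ.biUnion R)ᶜ, ?_, fun j => le_trans ?_ (hR j)⟩
  · have h1 : #(univ.biUnion R) ≤ ∑ j, if j = i then 0 else 1 :=
      card_biUnion_le.trans (sum_le_sum fun j _ => hRcard j)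
    have h2 : (∑ j, if j = i then 1 else 0) + (∑ j, if j = i then 0 else 1) = n := by
      rw [← sum_add_distrib]
      calc _ = ∑ _j : Fin n, 1 := sum_congr rfl fun j _ => by split_ifs <;> rfl
        _ = n := by simp
    have h3 := card_add_card_compl (univ.biUnion R)
    simp only [sum_ite_eq', mem_univ, if_true, Fintype.card_fin] at h2 h3
    omega
  · refine sum_le_sum_of_subset_of_nonneg ?_ fun g _ _ => hu i g
    intro g hg
    simp only [mem_filter, mem_compl, mem_biUnion, mem_univ, true_and, not_exists] at hg ⊢
    exact ⟨hg.2, hg.1 j⟩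

/-- The sum over a terminal segment is minimal among sums over sets of at least that size. -/
theorem Antitone.sum_terminal_le {m : ℕ} {v : Fin m → ℝ} (hv : Antitone v) (h0 : ∀ r, 0 ≤ v r)
    (a : ℕ) (T : Finset (Fin m)) (hT : m ≤ #T + a) :
    ∑ r with a ≤ r.val, v r ≤ ∑ r ∈ T, v r := by
  rcases le_or_gt m a with ha | ha
  · rw [filter_false_of_mem fun r _ => by omega]
    simpa using sum_nonneg fun r _ => h0 r
  set U : Finset (Fin m) := univ.filter fun r => a ≤ r.val with hU
  have hUcard : #U ≤ #T := by
    have h : U = Ici ⟨a, ha⟩ := by ext r; simp [hU, Fin.le_def]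
    rw [h, Fin.card_Ici]
    simp only
    omega
  have hcard : #(U \ T) ≤ #(T \ U) := by
    have h1 := card_sdiff_add_card_inter U T
    have h2 := card_sdiff_add_card_inter T U
    rw [inter_comm] at h2
    omega
  have h1 : ∑ r ∈ U \ T, v r ≤ #(U \ T) • v ⟨a, ha⟩ := by
    refine sum_le_card_nsmul _ _ _ fun r hr => hv ?_
    simpa [hU, Fin.le_def] using (mem_sdiff.1 hr).1
  have h2 : #(T \ U) • v ⟨a, ha⟩ ≤ ∑ r ∈ T \ U, v r := by
    refine card_nsmul_le_sum _ _ _ fun r hr => hv ?_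
    have := (mem_sdiff.1 hr).2
    simp only [hU, mem_filter, mem_univ, true_and, not_le] at this
    exact this.le
  have h3 := nsmul_le_nsmul_left (h0 ⟨a, ha⟩) hcard
  have h4 := sum_inter_add_sum_sdiff U T v
  have h5 := sum_inter_add_sum_sdiff T U v
  rw [inter_comm] at h5
  linarith

/-- Every block of `n` consecutive terms of an antitone sequence sums to at least `n` times its
last term. The term `(m % n) * w m` accounts for the incomplete last block. -/
theorem Antitone.mul_sum_dvd_le {w : ℕ → ℝ} (hw : Antitone w) {n m : ℕ} (hn : 1 ≤ n)
    (hm : n ≤ m) :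
    n * (∑ r ∈ range m with n ∣ r + 1, w r) + (m % n : ℕ) * w m
      ≤ (n - 1) * w (n - 1) + ∑ r ∈ range m with n - 1 ≤ r, w r := by
  induction m, hm using Nat.le_induction with
  | base =>
    have h1 : (range n).filter (fun r => n ∣ r + 1) = {n - 1} := by
      ext r
      simp only [mem_filter, mem_range, mem_singleton]
      constructor
      · rintro ⟨h, hd⟩
        have := Nat.le_of_dvd (by omega) hd
        omega
      · rintro rfl
        exact ⟨by omega, by rw [Nat.sub_add_cancel hn]⟩
    have h2 : (range n).filter (fun r => n - 1 ≤ r) = {n - 1} := by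
      ext r
      simp only [mem_filter, mem_range, mem_singleton]
      omega
    rw [h1, h2]
    simp only [sum_singleton, Nat.mod_self, Nat.cast_zero]
    linarith
  | succ m hm ih =>
    have hstep := hw (Nat.le_succ m)
    rw [range_add_one, filter_insert, filter_insert, if_pos (show n - 1 ≤ m by omega),
      sum_insert (by simp)]
    by_cases hd : n ∣ m + 1
    · rw [if_pos hd, sum_insert (by simp), Nat.mod_eq_zero_of_dvd hd]
      have hmod : m % n + 1 = n := by
        have h1 := Nat.mod_lt m hn
        have h2 : n ∣ m % n + 1 := by
          rw [Nat.dvd_iff_mod_eq_zero, Nat.mod_add_mod]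
          exact Nat.mod_eq_zero_of_dvd hd
        have := Nat.le_of_dvd (by omega) h2
        omega
      have hmod' : ((m % n : ℕ) : ℝ) = n - 1 := by
        rw [eq_sub_iff_add_eq]; exact_mod_cast hmod
      rw [hmod'] at ih
      push_cast
      linarith
    · rw [if_neg hd]
      have hmod : (m + 1) % n = m % n + 1 := by
        have h1 := Nat.mod_lt m hn
        rw [← Nat.mod_add_mod]
        refine Nat.mod_eq_of_lt (lt_of_le_of_ne h1 fun h => hd ?_)
        rw [Nat.dvd_iff_mod_eq_zero, ← Nat.mod_add_mod, show m % n + 1 = n from h, Nat.mod_self]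
      rw [hmod]
      have := mul_le_mul_of_nonneg_left hstep (Nat.cast_nonneg (α := ℝ) (m % n + 1))
      push_cast at this ⊢
      linarith

/-- The version of `Antitone.mul_sum_dvd_le` for a nonnegative finite sequence. -/
theorem Antitone.mul_sum_dvd_le_fin {m n : ℕ} {v : Fin m → ℝ} (hv : Antitone v)
    (h0 : ∀ r, 0 ≤ v r) (hn : 1 ≤ n) (hm : n ≤ m) :
    n * (∑ r : Fin m with n ∣ r.val + 1, v r)
      ≤ (n - 1) * v ⟨n - 1, by omega⟩ + ∑ r : Fin m with n - 1 ≤ r.val, v r := by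
  set w : ℕ → ℝ := fun r => if h : r < m then v ⟨r, h⟩ else 0 with hwdef
  have hwv : ∀ r : Fin m, w r = v r := fun r => by simp [hwdef]
  have hw : Antitone w := by
    intro a b hab
    simp only [hwdef]
    split_ifs with hb ha ha
    · exact hv hab
    · omega
    · exact h0 _
    · exact le_rfl
  have key := hw.mul_sum_dvd_le hn hm
  have hwm : w m = 0 := by simp [hwdef]
  have hsum : ∀ (P : ℕ → Prop) [DecidablePred P],
      ∑ r ∈ range m with P r, w r = ∑ r : Fin m with P r.val, v r := by
    intro P _
    rw [sum_filter, sum_filter, ← Fin.sum_univ_eq_sum_range (fun r => if P r then w r else 0)]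
    simp only [hwv]
  rw [hsum, hsum, hwm, mul_zero, add_zero] at key
  rwa [← hwv ⟨n - 1, by omega⟩]

/-- Bounds for a set `T` of ranks, coloured by `B`, each of whose colour classes has value at
most `x`. -/
theorem shares_le_of_colour_classes_le {n m : ℕ} (hn : 1 ≤ n) {v : Fin m → ℝ} (hv : Antitone v)
    (h0 : ∀ r, 0 ≤ v r) (B : Fin m → Fin n) (T : Finset (Fin m)) (hT : m + 1 ≤ #T + n) (x : ℝ)
    (hx : ∀ j, ∑ r ∈ T with B r = j, v r ≤ x) :
    (∑ r : Fin m with m - m / n ≤ r.val, v r ≤ x) ∧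
      n * (∑ r : Fin m with n ∣ r.val + 1, v r) ≤ (2 * n - 1) * x := by
  have hn' : (1 : ℝ) ≤ n := by exact_mod_cast hn
  have hx0 : 0 ≤ x := (sum_nonneg fun r _ => h0 r).trans (hx ⟨0, hn⟩)
  constructor
  · obtain ⟨j, hj⟩ : ∃ j, m / n ≤ #(T.filter fun r => B r = j) := by
      by_contra! h
      have h1 := card_eq_sum_card_fiberwise (s := T) (t := univ) (f := B) (by simp)
      have h2 : ∑ j, (#(T.filter fun r => B r = j) + 1) ≤ ∑ _j : Fin n, m / n :=
        sum_le_sum fun j _ => h j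
      rw [sum_add_distrib, ← h1] at h2
      simp only [sum_const, card_univ, Fintype.card_fin, smul_eq_mul, mul_one] at h2
      have := Nat.mul_div_le m n
      omega
    refine (hv.sum_terminal_le h0 _ _ ?_).trans (hx j)
    omega
  rcases lt_or_ge m n with hm | hm
  · rw [filter_false_of_mem fun r _ hd => by
      have := Nat.le_of_dvd (by omega) hd
      omega]
    simp only [sum_empty, mul_zero]
    exact mul_nonneg (by linarith) hx0
  have hblocks := hv.mul_sum_dvd_le_fin h0 hn hm
  have hrest : ∑ r : Fin m with n - 1 ≤ r.val, v r ≤ n * x := by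
    refine (hv.sum_terminal_le h0 _ T (by omega)).trans ?_
    rw [← sum_fiberwise T B]
    exact (sum_le_sum fun j _ => hx j).trans (by simp)
  have hfirst : v ⟨n - 1, by omega⟩ ≤ x := by
    obtain ⟨r, hrT, hr⟩ : ∃ r ∈ T, r.val ≤ n - 1 := by
      by_contra! h
      have h1 : T ⊆ Ioi ⟨n - 1, by omega⟩ := fun r hr => by
        simpa [Fin.lt_def] using h r hr
      have h2 := card_le_card h1
      rw [Fin.card_Ioi] at h2
      simp only at h2
      omega
    calc v ⟨n - 1, by omega⟩ ≤ v r := hv hr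
      _ ≤ ∑ r' ∈ T with B r' = B r, v r' :=
        single_le_sum (f := v) (fun r' _ => h0 r') (by simp [hrT])
      _ ≤ x := hx _
  have := mul_le_mul_of_nonneg_left hfirst (show (0 : ℝ) ≤ n - 1 by linarith)
  linarith

/-- For private goods division, every allocation satisfying EF1 also
satisfies (i) PPS, and (ii) `(n/(2n-1))`-RRS. -/
theorem EF1_implies_PPS_and_RRS_approx {n m : ℕ} (hn : 1 ≤ n)
    (u : Fin n → Fin m → ℝ) (hu : ∀ i g, 0 ≤ u i g) (A : Fin m → Fin n)
    (hEF1 : EF1 u A) :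
    (∀ i : Fin n, PPSshare u i ≤ bundleVal u A i i) ∧
    (∀ i : Fin n, ((n : ℝ) / (2 * n - 1)) * RRSshare u i ≤ bundleVal u A i i) := by
  have key : ∀ i, PPSshare u i ≤ bundleVal u A i i ∧
      n * RRSshare u i ≤ (2 * n - 1) * bundleVal u A i i := by
    intro i
    obtain ⟨T, hT, hx⟩ := hEF1.exists_envyFree_subset hu i
    set σ := Tuple.sort (fun j => -u i j) with hσ
    have hRRS : RRSshare u i = ∑ r : Fin m with n ∣ r.val + 1, sortedDesc (u i) r := by
      rw [RRSshare, sum_filter]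
      refine sum_congr rfl fun r _ => if_congr ?_ rfl rfl
      refine and_iff_left_of_imp fun ⟨k, hk⟩ => ?_
      rw [hk, mul_comm]
      refine Nat.mul_le_mul_right n ((Nat.le_div_iff_mul_le hn).2 ?_)
      rw [mul_comm, ← hk]
      exact r.isLt
    rw [PPSshare, ← sum_filter, hRRS]
    refine shares_le_of_colour_classes_le hn (sortedDesc_antitone (u i)) (fun r => hu i _)
      (A ∘ σ) (T.map σ.symm.toEmbedding) (by simpa using hT) _ fun j => ?_
    refine le_of_eq_of_le ?_ (hx j)
    rw [sum_filter, sum_map, sum_filter]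
    simp [sortedDesc, ← hσ]
  refine ⟨fun i => (key i).1, fun i => ?_⟩
  have hn' : (1 : ℝ) ≤ n := by exact_mod_cast hn
  rw [div_mul_eq_mul_div, div_le_iff₀ (by linarith), mul_comm (bundleVal u A i i)]
  exact (key i).2
end

section
/- For every n ≥ 3 there exists a private goods division instance with n players and n² goods, and an allocation A satisfying EF1, such that u_1(A_1) = (n/(2n−2))·RRS_1 (with RRS_1 = 2 > 0). Consequently, for private goods, EF1 does not imply α-RRS for any α > n/(2n−2). Explicitly: goods are g_1,…,g_{n²}; player 1 values u_1(g_j) = 1 for 1 ≤ j ≤ n and u_1(g_j) = 1/(n−1) for n+1 ≤ j ≤ n²; the allocation is A_1 = {g_{n+1},…,g_{2n}}, A_2 = {g_1, g_2}, and A_i = {g_i, g_{(i−1)n+1},…,g_{i·n}} for i > 2; each player i ≥ 2 has utility 1 for each good in A_i and 0 for all other goods. -/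
open Finset

lemma sum_range_mul_blocks (n k : ℕ) (f : ℕ → ℝ) :
    ∑ g ∈ Finset.range (n * k), f g =
      ∑ q ∈ Finset.range k, ∑ r ∈ Finset.range n, f (n * q + r) := by
  induction k with
  | zero => simp
  | succ k ih => rw [Nat.mul_succ, Finset.sum_range_add, ih, Finset.sum_range_succ]

lemma sum_fin_sq_blocks (n : ℕ) (f : ℕ → ℝ) :
    ∑ g : Fin (n ^ 2), f g.val =
      ∑ q ∈ Finset.range n, ∑ r ∈ Finset.range n, f (n * q + r) := by
  rw [Fin.sum_univ_eq_sum_range f (n ^ 2), sq, sum_range_mul_blocks]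

lemma sum_fin_sq_single_block (n k : ℕ) (hk : k < n) (c : ℝ) :
    (∑ g : Fin (n ^ 2), if g.val / n = k then c else 0) = n * c := by
  rw [sum_fin_sq_blocks n (fun g => if g / n = k then c else 0)]
  have h : ∀ q ∈ Finset.range n,
      (∑ r ∈ Finset.range n, if (n * q + r) / n = k then c else 0) =
        if q = k then n * c else 0 := by
    intro q _
    have h' : ∀ r ∈ Finset.range n,
        (if (n * q + r) / n = k then c else 0) = if q = k then c else 0 := by
      intro r hr
      rw [Nat.mul_add_div (by omega), Nat.div_eq_of_lt (Finset.mem_range.1 hr), add_zero]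
    rw [Finset.sum_congr rfl h']
    split_ifs <;> simp
  rw [Finset.sum_congr rfl h, Finset.sum_ite_eq' (Finset.range n) k]
  simp [hk]

lemma sortedDesc_of_antitone {m : ℕ} {f : Fin m → ℝ} (hf : Antitone f) : sortedDesc f = f := by
  have h : Tuple.sort (fun j => -f j) = Equiv.refl _ :=
    Tuple.sort_eq_refl_iff_monotone.2 fun _ _ hab => neg_le_neg (hf hab)
  funext r
  simp [sortedDesc, h]

/-- The owner of good `g`: player `1` gets goods `0` and `1`, player `0` gets the block
`n, …, 2n - 1`, and each player `j ≥ 2` gets good `j` and the block `jn, …, jn + n - 1`. -/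
def blockOwner (n g : ℕ) : ℕ :=
  if g < n then (if g ≤ 1 then 1 else g) else if g / n = 1 then 0 else g / n

lemma blockOwner_lt {n g : ℕ} (hn : 3 ≤ n) (hg : g < n ^ 2) : blockOwner n g < n := by
  have h : g / n < n := Nat.div_lt_of_lt_mul (by rwa [← sq])
  unfold blockOwner
  split_ifs <;> omega

lemma div_eq_zero_iff_block {n g : ℕ} (hn : 3 ≤ n) : g < n ↔ g / n = 0 := by
  rw [Nat.div_eq_zero_iff]; omega

lemma blockOwner_eq_zero {n g : ℕ} (hn : 3 ≤ n) : blockOwner n g = 0 ↔ g / n = 1 := by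
  have h := div_eq_zero_iff_block (g := g) hn
  unfold blockOwner
  grind

lemma blockOwner_eq_one {n g : ℕ} (hn : 3 ≤ n) : blockOwner n g = 1 ↔ g ≤ 1 := by
  have h := div_eq_zero_iff_block (g := g) hn
  unfold blockOwner
  grind

lemma blockOwner_eq_of_two_le {n g j : ℕ} (hn : 3 ≤ n) (hj : 2 ≤ j) (hjn : j < n) :
    blockOwner n g = j ↔ g = j ∨ g / n = j := by
  have h := div_eq_zero_iff_block (g := g) hn
  have h' := div_eq_zero_iff_block (g := j) hn
  unfold blockOwner
  by_cases hgj : g = j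
  · subst hgj; split_ifs <;> omega
  · split_ifs <;> omega

/-- The first player's value for good `g`. -/
noncomputable def firstValue (n g : ℕ) : ℝ := if g < n then 1 else 1 / ((n : ℝ) - 1)

lemma firstValue_antitone {n : ℕ} (hn : 3 ≤ n) : Antitone (firstValue n) := by
  have hn' : (3 : ℝ) ≤ n := by exact_mod_cast hn
  intro a b hab
  unfold firstValue
  split_ifs
  · exact le_rfl
  · omega
  · rw [div_le_one (by linarith)]; linarith
  · exact le_rfl

lemma firstValue_nonneg {n : ℕ} (hn : 3 ≤ n) (g : ℕ) : 0 ≤ firstValue n g := by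
  have hn' : (3 : ℝ) ≤ n := by exact_mod_cast hn
  unfold firstValue
  split_ifs
  · exact zero_le_one
  · exact div_nonneg zero_le_one (by linarith)

lemma sum_firstValue_block {n k : ℕ} (hk : 1 ≤ k) (hkn : k < n) :
    (∑ g : Fin (n ^ 2), if g.val / n = k then firstValue n g.val else 0) =
      n * (1 / ((n : ℝ) - 1)) := by
  rw [← sum_fin_sq_single_block n k hkn]
  refine Finset.sum_congr rfl fun g _ => ?_
  split_ifs with h
  · have : ¬ g.val < n := fun h' => by rw [Nat.div_eq_of_lt h'] at h; omega
    simp [firstValue, this]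
  · rfl

lemma sum_firstValue_roundRobin {n : ℕ} (hn : 3 ≤ n) :
    (∑ r : Fin (n ^ 2), if n ∣ r.val + 1 ∧ r.val + 1 ≤ n ^ 2 / n * n
      then firstValue n r.val else 0) = 2 := by
  have hn' : (3 : ℝ) ≤ n := by exact_mod_cast hn
  have hdiv : n ^ 2 / n * n = n ^ 2 := Nat.div_mul_cancel (Dvd.intro_left n (sq n).symm)
  have hdrop : ∀ r : Fin (n ^ 2), (n ∣ r.val + 1 ∧ r.val + 1 ≤ n ^ 2 / n * n) ↔
      n ∣ r.val + 1 := fun r => by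
    rw [hdiv]; exact and_iff_left r.isLt
  simp only [hdrop]
  rw [sum_fin_sq_blocks n fun g => if n ∣ g + 1 then firstValue n g else 0]
  have h : ∀ q ∈ Finset.range n,
      (∑ r ∈ Finset.range n, if n ∣ n * q + r + 1 then firstValue n (n * q + r) else 0) =
        firstValue n (n * q + (n - 1)) := by
    intro q _
    rw [Finset.sum_eq_single_of_mem (n - 1) (Finset.mem_range.2 (by omega))]
    · rw [if_pos]
      exact ⟨q + 1, by rw [Nat.mul_succ]; omega⟩
    · intro r hr hne
      rw [if_neg]
      rw [add_assoc, Nat.dvd_add_right (Dvd.intro q rfl)]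
      intro hd
      have := Nat.le_of_dvd (by omega) hd
      rw [Finset.mem_range] at hr
      omega
  rw [Finset.sum_congr rfl h]
  obtain ⟨k, rfl⟩ : ∃ k, n = k + 1 := ⟨n - 1, by omega⟩
  rw [Finset.sum_range_succ']
  have h' : ∀ q ∈ Finset.range k,
      firstValue (k + 1) ((k + 1) * (q + 1) + (k + 1 - 1)) = 1 / (k : ℝ) := by
    intro q _
    simp [firstValue]
  rw [Finset.sum_congr rfl h']
  have hk : (k : ℝ) ≠ 0 := by
    push_cast at hn'
    intro h0
    linarith
  simp [firstValue, hk]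
  norm_num

/-- For every `n ≥ 3` there is a private goods division instance with
`n` players and `n²` goods and an allocation `A` satisfying EF1 such that player 1 (index
`0`) has round robin share `RRS_1 = 2 > 0` but receives exactly a `n/(2n-2)` fraction of
it. Hence, for private goods, EF1 does not imply `α`-RRS for any `α > n/(2n-2)`. -/
theorem EF1_RRS_upper_bound (n : ℕ) (hn : 3 ≤ n) :
    ∃ (u : Fin n → Fin (n ^ 2) → ℝ) (A : Fin (n ^ 2) → Fin n),
      (∀ i g, 0 ≤ u i g) ∧ EF1 u A ∧
      RRSshare u ⟨0, by omega⟩ = 2 ∧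
      bundleVal u A ⟨0, by omega⟩ ⟨0, by omega⟩ =
        ((n : ℝ) / (2 * n - 2)) * RRSshare u ⟨0, by omega⟩ := by
  have hn' : (3 : ℝ) ≤ n := by exact_mod_cast hn
  have hsq : n < n ^ 2 := by nlinarith
  let A : Fin (n ^ 2) → Fin n := fun g => ⟨blockOwner n g.val, blockOwner_lt hn g.isLt⟩
  let u : Fin n → Fin (n ^ 2) → ℝ := fun i g =>
    if i.val = 0 then firstValue n g.val else if A g = i then 1 else 0
  have hu : ∀ i g, 0 ≤ u i g := by
    intro i g
    simp only [u]
    split_ifs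
    · exact firstValue_nonneg hn _
    · exact zero_le_one
    · exact le_rfl
  have hA : ∀ g j, A g = j ↔ blockOwner n g.val = j.val := fun g j => Fin.ext_iff
  have hu0 : u ⟨0, by omega⟩ = fun g => firstValue n g.val := by
    funext g; simp [u]
  have hself : bundleVal u A ⟨0, by omega⟩ ⟨0, by omega⟩ = n * (1 / ((n : ℝ) - 1)) := by
    simp only [bundleVal, hu0, hA, blockOwner_eq_zero hn]
    exact sum_firstValue_block le_rfl (by omega)
  have hRRS : RRSshare u ⟨0, by omega⟩ = 2 := by
    have hanti : Antitone fun g : Fin (n ^ 2) => firstValue n g.val :=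
      fun a b hab => firstValue_antitone hn hab
    simp only [RRSshare, hu0, sortedDesc_of_antitone hanti]
    exact sum_firstValue_roundRobin hn
  refine ⟨u, A, hu, ?_, hRRS, ?_⟩
  · intro i j
    by_cases hij : i = j
    · exact Or.inl (by rw [hij])
    by_cases hi : i.val = 0
    · obtain ⟨i, _⟩ := i
      obtain rfl : i = 0 := hi
      have hj0 : j.val ≠ 0 := fun h => hij (Fin.ext h.symm)
      right
      rw [hself]
      by_cases hj1 : j.val = 1
      · refine ⟨⟨0, by omega⟩, by rw [hA, hj1, blockOwner_eq_one hn]; exact zero_le_one, ?_⟩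
        have h : ∀ g : Fin (n ^ 2), (A g = j ∧ g ≠ ⟨0, by omega⟩) ↔ g = ⟨1, by omega⟩ := by
          intro g
          rw [hA, hj1, blockOwner_eq_one hn, ne_eq, Fin.ext_iff, Fin.ext_iff]
          simp only
          omega
        simp only [h, hu0, Finset.sum_ite_eq', Finset.mem_univ, if_true]
        have h1 : firstValue n 1 = 1 := if_pos (by omega)
        rw [h1, mul_one_div, one_le_div (by linarith)]
        linarith
      · have hj2 : 2 ≤ j.val := by omega
        have hown := fun g : ℕ => blockOwner_eq_of_two_le (g := g) hn hj2 j.isLt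
        refine ⟨⟨j.val, by omega⟩, by rw [hA, hown]; exact Or.inl rfl, le_of_eq ?_⟩
        rw [← sum_firstValue_block (k := j.val) (by omega) j.isLt]
        refine Finset.sum_congr rfl fun g _ => ?_
        have h : (A g = j ∧ g ≠ ⟨j.val, by omega⟩) ↔ g.val / n = j.val := by
          rw [hA, hown, ne_eq, Fin.ext_iff]
          have h0 := Nat.div_eq_of_lt j.isLt
          constructor
          · rintro ⟨h1 | h1, h2⟩
            · exact absurd h1 h2
            · exact h1
          · intro h1
            refine ⟨Or.inr h1, fun h2 => ?_⟩
            simp only at h2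
            rw [h2, h0] at h1
            omega
        simp only [h, hu0]
    · left
      have h : bundleVal u A i j = 0 := by
        refine Finset.sum_eq_zero fun g _ => ?_
        split_ifs with h
        · simp [u, hi, h, Ne.symm hij]
        · rfl
      rw [h]
      refine Finset.sum_nonneg fun g _ => ?_
      split_ifs
      · exact hu i g
      · exact le_rfl
  · rw [hself, hRRS]
    have h1 : (n : ℝ) - 1 ≠ 0 := by intro h; linarith
    have h2 : 2 * (n : ℝ) - 2 ≠ 0 := by intro h; linarith
    field_simp
end

section
/- In any private goods division instance, every maximum Nash welfare (MNW) allocation A satisfies both PPS (u_i(A_i) ≥ PPS_i for every player i) and (n/(2n−1))-RRS (u_i(A_i) ≥ (n/(2n−1))·RRS_i for every player i). -/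
open Finset

theorem bundleVal_eq_sum_filter {n m : ℕ} (u : Fin n → Fin m → ℝ) (A : Fin m → Fin n)
    (i j : Fin n) : bundleVal u A i j = ∑ g with A g = j, u i g := by
  rw [bundleVal, Finset.sum_filter]

theorem bundleVal_nonneg {n m : ℕ} {u : Fin n → Fin m → ℝ} (hu : ∀ i g, 0 ≤ u i g)
    (A : Fin m → Fin n) (i j : Fin n) : 0 ≤ bundleVal u A i j := by
  rw [bundleVal_eq_sum_filter]
  exact Finset.sum_nonneg fun g _ => hu i g

/-- Utility of the receiving player after one good is transferred to her. -/
theorem bundleVal_update_self {n m : ℕ} (u : Fin n → Fin m → ℝ) (A : Fin m → Fin n)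
    {i : Fin n} {g : Fin m} (hg : A g ≠ i) :
    bundleVal u (Function.update A g i) i i = bundleVal u A i i + u i g := by
  simp only [bundleVal]
  rw [← Finset.add_sum_erase _ _ (mem_univ g), ← Finset.add_sum_erase univ
    (fun x => if A x = i then u i x else 0) (mem_univ g)]
  have : ∑ x ∈ univ.erase g, (if Function.update A g i x = i then u i x else 0)
      = ∑ x ∈ univ.erase g, (if A x = i then u i x else 0) := by
    refine Finset.sum_congr rfl fun x hx => ?_
    rw [Function.update_of_ne (Finset.ne_of_mem_erase hx)]
  rw [this]
  simp [hg]
  ring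

/-- Utility of the giving player after one good is transferred away from her. -/
theorem bundleVal_update_owner {n m : ℕ} (u : Fin n → Fin m → ℝ) (A : Fin m → Fin n)
    {i : Fin n} {g : Fin m} (hg : A g ≠ i) :
    bundleVal u (Function.update A g i) (A g) (A g) =
      bundleVal u A (A g) (A g) - u (A g) g := by
  simp only [bundleVal]
  rw [← Finset.add_sum_erase _ _ (mem_univ g), ← Finset.add_sum_erase univ
    (fun x => if A x = A g then u (A g) x else 0) (mem_univ g)]
  have : ∑ x ∈ univ.erase g, (if Function.update A g i x = A g then u (A g) x else 0)
      = ∑ x ∈ univ.erase g, (if A x = A g then u (A g) x else 0) := by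
    refine Finset.sum_congr rfl fun x hx => ?_
    rw [Function.update_of_ne (Finset.ne_of_mem_erase hx)]
  rw [this]
  simp [Ne.symm hg]

/-- Transferring a good does not affect the players who are not involved. -/
theorem bundleVal_update_of_ne {n m : ℕ} (u : Fin n → Fin m → ℝ) (A : Fin m → Fin n)
    {i k : Fin n} {g : Fin m} (hi : k ≠ i) (hj : k ≠ A g) :
    bundleVal u (Function.update A g i) k k = bundleVal u A k k := by
  simp only [bundleVal]
  refine Finset.sum_congr rfl fun x _ => ?_
  by_cases hx : x = g
  · subst hx
    simp [Ne.symm hi, Ne.symm hj]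
  · rw [Function.update_of_ne hx]

/-- In a bundle that player `i` values, some good valued by `i` has a ratio of the values of
`j` and `i` that is at most the corresponding ratio for the whole bundle. -/
theorem exists_mul_le_mul_of_sum_pos {ι : Type*} (s : Finset ι) {a b : ι → ℝ}
    (ha : ∀ g, 0 ≤ a g) (hb : ∀ g, 0 ≤ b g) (hpos : 0 < ∑ g ∈ s, a g) :
    ∃ g ∈ s, 0 < a g ∧ b g * ∑ x ∈ s, a x ≤ a g * ∑ x ∈ s, b x := by
  by_contra! h
  obtain ⟨g, hg, hag⟩ : ∃ g ∈ s, 0 < a g := by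
    by_contra! h'
    exact absurd (Finset.sum_nonpos h') (not_le.2 hpos)
  have : ∑ g ∈ s, a g * ∑ x ∈ s, b x < ∑ g ∈ s, b g * ∑ x ∈ s, a x := by
    refine Finset.sum_lt_sum (fun x hx => ?_) ⟨g, hg, h g hg hag⟩
    rcases (ha x).eq_or_lt with h0 | h0
    · rw [← h0, zero_mul]
      exact mul_nonneg (hb x) hpos.le
    · exact (h x hx h0).le
  rw [← Finset.sum_mul, ← Finset.sum_mul, mul_comm] at this
  exact lt_irrefl _ this

/-- Every maximum Nash welfare allocation is envy-free up to one good. -/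
theorem MNWalloc.ef1 {n m : ℕ} {u : Fin n → Fin m → ℝ} (hu : ∀ i g, 0 ≤ u i g)
    {A : Fin m → Fin n} (hA : MNWalloc u A) : EF1 u A := by
  intro i j
  by_contra! h
  obtain ⟨henvy, hrem⟩ := h
  have hij : j ≠ i := by
    rintro rfl
    exact lt_irrefl _ henvy
  have hv := bundleVal_nonneg hu A i i
  obtain ⟨g, hgj, hpos, hratio⟩ := exists_mul_le_mul_of_sum_pos (univ.filter fun g => A g = j)
    (hu i) (hu j) (by rw [← bundleVal_eq_sum_filter]; linarith)
  rw [← bundleVal_eq_sum_filter, ← bundleVal_eq_sum_filter] at hratio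
  have hgj : A g = j := by simpa using hgj
  have hrem' : bundleVal u A i i < bundleVal u A i j - u i g := by
    refine (hrem g hgj).trans_eq ?_
    rw [bundleVal_eq_sum_filter, ← Finset.sum_filter, eq_sub_iff_add_eq,
      ← Finset.sum_erase_add _ _ (by simpa using hgj : g ∈ univ.filter fun x => A x = j)]
    congr 2
    ext x
    simp [and_comm]
  have hgi : A g ≠ i := hgj ▸ hij
  have hi := bundleVal_update_self u A hgi
  have hj := bundleVal_update_owner u A hgi
  rw [hgj] at hj
  have hother : ∀ k, k ≠ i → k ≠ j →
      bundleVal u (Function.update A g i) k k = bundleVal u A k k :=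
    fun k hk hk' => bundleVal_update_of_ne u A hk (hgj ▸ hk')
  have hw := bundleVal_nonneg hu A j j
  have hjpos : 0 < bundleVal u A j j → 0 < bundleVal u (Function.update A g i) j j := by
    intro hw
    rw [hj]
    by_contra! hle
    nlinarith
  obtain ⟨hcard, hprod⟩ := hA
  specialize hcard (Function.update A g i)
  specialize hprod (Function.update A g i)
  generalize Function.update A g i = B at *
  rcases hv.eq_or_lt with hv0 | hv0
  · refine absurd hcard (not_le.2 (Finset.card_lt_card ?_))
    refine (Finset.ssubset_iff_of_subset fun k hk => ?_).2 ⟨i, ?_, ?_⟩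
    · simp only [mem_filter, mem_univ, true_and] at hk ⊢
      by_cases hki : k = i
      · subst hki
        linarith
      by_cases hkj : k = j
      · subst hkj
        exact hjpos hk
      · rwa [hother k hki hkj]
    · simp only [mem_filter, mem_univ, true_and]
      linarith
    · simp [← hv0]
  · set S := univ.filter fun k => 0 < bundleVal u A k k with hS
    have hiS : i ∈ S := by simpa [hS] using hv0
    rw [← Finset.mul_prod_erase S _ hiS, ← Finset.mul_prod_erase S _ hiS] at hprod
    by_cases hjS : 0 < bundleVal u A j j
    · have hjS' : j ∈ S.erase i := by simp [hS, hij, hjS]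
      rw [← Finset.mul_prod_erase _ _ hjS', ← Finset.mul_prod_erase _ _ hjS'] at hprod
      have hrest : ∏ k ∈ (S.erase i).erase j, bundleVal u B k k =
          ∏ k ∈ (S.erase i).erase j, bundleVal u A k k := by
        refine Finset.prod_congr rfl fun k hk => ?_
        simp only [mem_erase] at hk
        exact hother k hk.2.1 hk.1
      have hP : 0 < ∏ k ∈ (S.erase i).erase j, bundleVal u A k k := by
        refine Finset.prod_pos fun k hk => ?_
        simp only [mem_erase, hS, mem_filter] at hk
        exact hk.2.2.2
      rw [hrest, ← mul_assoc, ← mul_assoc] at hprod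
      have hle := le_of_mul_le_mul_right hprod hP
      rw [hi, hj] at hle
      rcases (hu j g).eq_or_lt with h0 | h0
      · rw [← h0] at hle
        nlinarith [mul_pos hpos hjS]
      · nlinarith [mul_lt_mul_of_pos_left hrem' h0]
    · have hrest : ∏ k ∈ S.erase i, bundleVal u B k k =
          ∏ k ∈ S.erase i, bundleVal u A k k := by
        refine Finset.prod_congr rfl fun k hk => ?_
        simp only [mem_erase, hS, mem_filter] at hk
        refine hother k hk.1 ?_
        rintro rfl
        exact hjS hk.2.2
      have hP : 0 < ∏ k ∈ S.erase i, bundleVal u A k k := by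
        refine Finset.prod_pos fun k hk => ?_
        simp only [mem_erase, hS, mem_filter] at hk
        exact hk.2.2
      rw [hrest] at hprod
      have hle := le_of_mul_le_mul_right hprod hP
      linarith

/-- The `k` smallest terms of a nonnegative antitone sequence sum to at most the sum over any
set of at least `k` indices. -/
theorem sum_smallest_le_sum_of_antitone {m k : ℕ} {s : Fin m → ℝ} (hs : Antitone s)
    (h0 : ∀ r, 0 ≤ s r) (T : Finset (Fin m)) (hk : k ≤ T.card) :
    ∑ r : Fin m with m - k ≤ r.val, s r ≤ ∑ r ∈ T, s r := by
  rcases Nat.eq_zero_or_pos k with rfl | hkpos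
  · rw [Finset.sum_eq_zero]
    · exact Finset.sum_nonneg fun r _ => h0 r
    · intro r hr
      have := (Finset.mem_filter.1 hr).2
      omega
  have hkm : k ≤ m := hk.trans (by simpa using T.card_le_univ)
  let c : Fin m := ⟨m - k, by omega⟩
  have hB : (univ.filter fun r : Fin m => m - k ≤ r.val) = Finset.Ici c := by
    ext r
    simp [c, Fin.le_def]
  rw [hB]
  have hBcard : (Finset.Ici c).card = k := by
    rw [Fin.card_Ici]
    simp only [c]
    omega
  have hcard : (Finset.Ici c \ T).card ≤ (T \ Finset.Ici c).card := by
    have h1 := Finset.card_sdiff_add_card_inter (Finset.Ici c) T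
    have h2 := Finset.card_sdiff_add_card_inter T (Finset.Ici c)
    rw [Finset.inter_comm] at h2
    omega
  rw [← Finset.sum_inter_add_sum_sdiff (Finset.Ici c) T,
    ← Finset.sum_inter_add_sum_sdiff T (Finset.Ici c), Finset.inter_comm T]
  refine add_le_add le_rfl ?_
  calc ∑ r ∈ Finset.Ici c \ T, s r ≤ (Finset.Ici c \ T).card • s c := by
        refine Finset.sum_le_card_nsmul _ _ _ fun r hr => hs ?_
        exact Finset.mem_Ici.1 (Finset.mem_sdiff.1 hr).1
    _ ≤ (T \ Finset.Ici c).card • s c := nsmul_le_nsmul_left (h0 c) hcard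
    _ ≤ ∑ r ∈ T \ Finset.Ici c, s r := by
        refine Finset.card_nsmul_le_sum _ _ _ fun r hr => hs ?_
        have := (Finset.mem_sdiff.1 hr).2
        simp only [Finset.mem_Ici, not_le] at this
        exact this.le

/-- The `k` smallest values sum to at most the value of any set of at least `k` goods. -/
theorem sum_smallest_sortedDesc_le {m k : ℕ} {f : Fin m → ℝ} (h0 : ∀ g, 0 ≤ f g)
    (T : Finset (Fin m)) (hk : k ≤ T.card) :
    ∑ r : Fin m with m - k ≤ r.val, sortedDesc f r ≤ ∑ g ∈ T, f g := by
  let σ := Tuple.sort fun j => -f j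
  refine (sum_smallest_le_sum_of_antitone (sortedDesc_antitone f) (fun r => h0 _)
    (T.map σ.symm.toEmbedding) (by simpa using hk)).trans_eq ?_
  simp [sortedDesc, σ]

/-- A multiple of the round robin share, bounded block by block. -/
theorem sum_mul_le_of_antitone {f : ℕ → ℝ} (hf : Antitone f) {n : ℕ} (hn : 1 ≤ n) (q : ℕ) :
    (n : ℝ) * ∑ k ∈ range (q + 1), f ((k + 1) * n - 1) ≤
      (n - 1) * f (n - 1) + ∑ t ∈ Ico (n - 1) ((q + 1) * n), f t := by
  induction q with
  | zero =>
    have : Ico (n - 1) n = {n - 1} := by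
      ext t
      simp only [mem_Ico, mem_singleton]
      omega
    simp [this]
    linarith
  | succ q ih =>
    rw [Finset.sum_range_succ, mul_add]
    have hmul : (q + 1 + 1) * n = (q + 1) * n + n := by ring
    have hle : n ≤ (q + 1) * n := Nat.le_mul_of_pos_left _ (by omega)
    rw [← Finset.sum_Ico_consecutive f (by omega : n - 1 ≤ (q + 1) * n)
      (by omega : (q + 1) * n ≤ (q + 1 + 1) * n)]
    have hblock : (n : ℝ) * f ((q + 1 + 1) * n - 1) ≤
        ∑ t ∈ Ico ((q + 1) * n) ((q + 1 + 1) * n), f t := by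
      have := Finset.card_nsmul_le_sum (Ico ((q + 1) * n) ((q + 1 + 1) * n)) f
        (f ((q + 1 + 1) * n - 1)) (fun t ht => hf (by
          have := (mem_Ico.1 ht).2
          omega))
      rwa [Nat.card_Ico, show (q + 1 + 1) * n - (q + 1) * n = n by omega,
        nsmul_eq_mul] at this
    linarith

/-- The round robin share is bounded in terms of the `n`-th largest value and the total of
all values from the `n`-th largest on. -/
theorem mul_RRSshare_le {n m : ℕ} (hn : 1 ≤ n) {u : Fin n → Fin m → ℝ}
    (hu : ∀ i g, 0 ≤ u i g) (i : Fin n) (hnm : n ≤ m) :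
    (n : ℝ) * RRSshare u i ≤ (n - 1) * sortedDesc (u i) ⟨n - 1, by omega⟩ +
      ∑ r : Fin m with n - 1 ≤ r.val, sortedDesc (u i) r := by
  let f : ℕ → ℝ := fun k => if h : k < m then sortedDesc (u i) ⟨k, h⟩ else 0
  have hfr : ∀ r : Fin m, sortedDesc (u i) r = f r.val := fun r => by simp [f]
  have hf0 : ∀ k, 0 ≤ f k := by
    intro k
    simp only [f]
    split
    · exact hu i _
    · exact le_rfl
  have hf : Antitone f := by
    intro a b hab
    by_cases hb : b < m
    · simp only [f, hb, hab.trans_lt hb, dif_pos]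
      exact sortedDesc_antitone _ hab
    · have : f b = 0 := by simp [f, hb]
      rw [this]
      exact hf0 a
  obtain ⟨q, hq⟩ : ∃ q, m / n = q + 1 :=
    Nat.exists_eq_succ_of_ne_zero (Nat.div_pos hnm hn).ne'
  have hqm : (q + 1) * n ≤ m := hq ▸ Nat.div_mul_le_self m n
  have hRRS : RRSshare u i ≤ ∑ k ∈ range (q + 1), f ((k + 1) * n - 1) := by
    have h1 : RRSshare u i =
        ∑ r ∈ range m, if n ∣ (r + 1) ∧ r + 1 ≤ (m / n) * n then f r else 0 := by
      rw [Finset.sum_range]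
      simp only [RRSshare, hfr]
    have hinj : Set.InjOn (fun k => (k + 1) * n - 1) (range (q + 1) : Set ℕ) := by
      intro a _ b _ hab
      have ha : 1 ≤ (a + 1) * n := Nat.mul_pos (by omega) hn
      have hb : 1 ≤ (b + 1) * n := Nat.mul_pos (by omega) hn
      have hab' : (a + 1) * n = (b + 1) * n := by
        simp only at hab
        omega
      have := Nat.eq_of_mul_eq_mul_right hn hab'
      omega
    rw [h1, ← Finset.sum_filter, ← Finset.sum_image hinj]
    refine Finset.sum_le_sum_of_subset_of_nonneg ?_ fun k _ _ => hf0 k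
    intro r hr
    simp only [mem_filter, mem_range] at hr
    obtain ⟨_, ⟨c, hc⟩, hle⟩ := hr
    rw [hq, hc, mul_comm n c] at hle
    have hc' := Nat.le_of_mul_le_mul_right hle hn
    have hc0 : c ≠ 0 := by
      rintro rfl
      omega
    simp only [mem_image, mem_range]
    refine ⟨c - 1, by omega, ?_⟩
    rw [Nat.sub_add_cancel (by omega), mul_comm, ← hc]
    rfl
  have htail : ∑ t ∈ Ico (n - 1) ((q + 1) * n), f t ≤
      ∑ r : Fin m with n - 1 ≤ r.val, sortedDesc (u i) r := by
    have h1 : ∑ r : Fin m with n - 1 ≤ r.val, sortedDesc (u i) r =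
        ∑ t ∈ range m, if n - 1 ≤ t then f t else 0 := by
      rw [Finset.sum_range, Finset.sum_filter]
      simp only [hfr]
    rw [h1, ← Finset.sum_filter]
    refine Finset.sum_le_sum_of_subset_of_nonneg ?_ fun k _ _ => hf0 k
    intro t ht
    simp only [mem_Ico, mem_filter, mem_range] at ht ⊢
    omega
  have := sum_mul_le_of_antitone hf hn q
  rw [hfr]
  have := mul_le_mul_of_nonneg_left hRRS (Nat.cast_nonneg (α := ℝ) n)
  simp only at *
  linarith

/-- Envy-freeness up to one good, with the removed goods collected in a set. -/
theorem EF1.exists_finset {n m : ℕ} {u : Fin n → Fin m → ℝ} {A : Fin m → Fin n}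
    (hA : EF1 u A) (i j : Fin n) :
    ∃ R : Finset (Fin m), R.card ≤ (if j = i then 0 else 1) ∧
      ∑ g with A g = j ∧ g ∉ R, u i g ≤ bundleVal u A i i := by
  by_cases hij : j = i
  · subst hij
    exact ⟨∅, by simp, by simp [bundleVal_eq_sum_filter]⟩
  · rcases hA i j with h | ⟨g0, -, h⟩
    · exact ⟨∅, by simp, by simpa [bundleVal_eq_sum_filter] using h⟩
    · refine ⟨{g0}, by simp [hij], ?_⟩
      rw [← Finset.sum_filter] at h
      simpa using h

/-- Removing at most one good from each other bundle, the remaining value is at most `n` times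
the utility of the player. -/
theorem EF1.sum_smallest_le {n m : ℕ} {u : Fin n → Fin m → ℝ}
    (hu : ∀ i g, 0 ≤ u i g) {A : Fin m → Fin n} (hA : EF1 u A) (i : Fin n) :
    ∑ r : Fin m with m - (m - (n - 1)) ≤ r.val, sortedDesc (u i) r ≤
      n * bundleVal u A i i := by
  choose R hR hle using hA.exists_finset i
  have hcard : (univ.biUnion R).card ≤ n - 1 := by
    refine Finset.card_biUnion_le.trans ((Finset.sum_le_sum fun j _ => hR j).trans ?_)
    rw [← Finset.add_sum_erase _ _ (mem_univ i), Finset.sum_congr rfl (g := fun _ => 1)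
      (fun j hj => if_neg (Finset.ne_of_mem_erase hj))]
    simp
  refine (sum_smallest_sortedDesc_le (hu i) (univ.biUnion R)ᶜ ?_).trans ?_
  · rw [Finset.card_compl, Fintype.card_fin]
    omega
  · rw [← Finset.sum_fiberwise (univ.biUnion R)ᶜ A (u i)]
    calc ∑ j, ∑ g ∈ (univ.biUnion R)ᶜ with A g = j, u i g
        ≤ ∑ _j : Fin n, bundleVal u A i i := by
          refine Finset.sum_le_sum fun j _ => le_trans ?_ (hle j)
          refine Finset.sum_le_sum_of_subset_of_nonneg ?_ fun g _ _ => hu i g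
          intro g hg
          simp only [mem_filter, mem_compl, mem_biUnion, mem_univ, true_and, not_exists] at hg ⊢
          exact ⟨hg.2, hg.1 j⟩
      _ = n * bundleVal u A i i := by simp

/-- Under EF1, every player gets at least her `n`-th largest value. -/
theorem EF1.sortedDesc_le {n m : ℕ} {u : Fin n → Fin m → ℝ}
    (hu : ∀ i g, 0 ≤ u i g) {A : Fin m → Fin n} (hA : EF1 u A) (i : Fin n) (hnm : n ≤ m)
    (h : n - 1 < m) : sortedDesc (u i) ⟨n - 1, h⟩ ≤ bundleVal u A i i := by
  let good : Fin n → Fin m := fun k => Tuple.sort (fun j => -u i j) (Fin.castLE hnm k)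
  have hgood : ∀ k, sortedDesc (u i) ⟨n - 1, h⟩ ≤ u i (good k) := by
    intro k
    refine sortedDesc_antitone (u i) (a := Fin.castLE hnm k) ?_
    have := k.isLt
    simp only [Fin.le_def, Fin.val_castLE]
    omega
  have hinj : Function.Injective good :=
    (Equiv.injective _).comp (Fin.castLE_injective hnm)
  by_cases hi : ∃ k, A (good k) = i
  · obtain ⟨k, hk⟩ := hi
    refine (hgood k).trans ?_
    rw [bundleVal_eq_sum_filter]
    exact Finset.single_le_sum (f := u i) (fun g _ => hu i g) (by simpa using hk)
  · have hninj : ¬ Function.Injective (A ∘ good) := fun hc =>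
      hi (Finite.surjective_of_injective hc i)
    simp only [Function.Injective, not_forall, Function.comp] at hninj
    obtain ⟨a, b, hab, hne⟩ := hninj
    obtain ⟨R, hR, hle⟩ := hA.exists_finset i (A (good b))
    have hR1 : R.card ≤ 1 := hR.trans (by split <;> simp)
    obtain ⟨c, hc, hcR⟩ : ∃ c, A (good c) = A (good b) ∧ good c ∉ R := by
      by_contra! hc
      exact hne (hinj (Finset.card_le_one.1 hR1 _ (hc a hab) _ (hc b rfl)))
    refine (hgood c).trans (le_trans ?_ hle)
    exact Finset.single_le_sum (f := u i) (fun g _ => hu i g) (by simp [hc, hcR])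

/-- EF1 implies the pessimistic proportional share. -/
theorem EF1.PPSshare_le {n m : ℕ} {u : Fin n → Fin m → ℝ}
    (hu : ∀ i g, 0 ≤ u i g) {A : Fin m → Fin n} (hA : EF1 u A) (i : Fin n) :
    PPSshare u i ≤ bundleVal u A i i := by
  rw [PPSshare, ← Finset.sum_filter]
  by_cases hi : m / n ≤ (univ.filter fun g => A g = i).card
  · rw [bundleVal_eq_sum_filter]
    exact sum_smallest_sortedDesc_le (hu i) _ hi
  obtain ⟨j, hj⟩ : ∃ j, m / n + 1 ≤ (univ.filter fun g => A g = j).card := by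
    by_contra! hall
    have hsum : ∑ j, (univ.filter fun g => A g = j).card = m := by
      simpa using (Finset.card_eq_sum_card_fiberwise (f := A) (s := univ) (t := univ)
        (by simp)).symm
    have hlt : ∑ j, (univ.filter fun g => A g = j).card < ∑ _j : Fin n, m / n :=
      Finset.sum_lt_sum (fun j _ => Nat.lt_succ_iff.1 (hall j)) ⟨i, mem_univ i, not_le.1 hi⟩
    rw [hsum] at hlt
    simp only [sum_const, card_univ, Fintype.card_fin, smul_eq_mul] at hlt
    exact absurd (Nat.mul_div_le m n) (not_le.2 hlt)
  obtain ⟨R, hR, hle⟩ := hA.exists_finset i j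
  have hR1 : R.card ≤ 1 := hR.trans (by split <;> simp)
  refine (sum_smallest_sortedDesc_le (hu i) _ ?_).trans hle
  have : (univ.filter fun g => A g = j ∧ g ∉ R) = (univ.filter fun g => A g = j) \ R := by
    ext g
    simp
  rw [this]
  have := Finset.le_card_sdiff R (univ.filter fun g => A g = j)
  omega

/-- EF1 implies the `n/(2n-1)` approximation of the round robin share. -/
theorem EF1.mul_RRSshare_le {n m : ℕ} (hn : 1 ≤ n) {u : Fin n → Fin m → ℝ}
    (hu : ∀ i g, 0 ≤ u i g) {A : Fin m → Fin n} (hA : EF1 u A) (i : Fin n) :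
    ((n : ℝ) / (2 * n - 1)) * RRSshare u i ≤ bundleVal u A i i := by
  have hn' : (1 : ℝ) ≤ n := by exact_mod_cast hn
  rcases lt_or_ge m n with hmn | hnm
  · have : RRSshare u i = 0 := by
      refine Finset.sum_eq_zero fun r _ => if_neg ?_
      rw [Nat.div_eq_of_lt hmn]
      omega
    rw [this, mul_zero]
    exact bundleVal_nonneg hu A i i
  · have h1 := _root_.mul_RRSshare_le hn hu i hnm
    have h2 := hA.sum_smallest_le hu i
    have h3 := hA.sortedDesc_le hu i hnm (by omega)
    rw [show m - (m - (n - 1)) = n - 1 by omega] at h2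
    have h4 := mul_le_mul_of_nonneg_left h3 (sub_nonneg.2 hn')
    rw [div_mul_eq_mul_div, div_le_iff₀ (by linarith)]
    linarith

/-- For private goods division, every maximum Nash welfare allocation
satisfies both PPS and `(n/(2n-1))`-RRS. -/
theorem MNW_alloc_PPS_and_RRS_approx {n m : ℕ} (hn : 1 ≤ n)
    (u : Fin n → Fin m → ℝ) (hu : ∀ i g, 0 ≤ u i g) (A : Fin m → Fin n)
    (hMNW : MNWalloc u A) :
    (∀ i : Fin n, PPSshare u i ≤ bundleVal u A i i) ∧
    (∀ i : Fin n, ((n : ℝ) / (2 * n - 1)) * RRSshare u i ≤ bundleVal u A i i) :=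
  ⟨(hMNW.ef1 hu).PPSshare_le hu, (hMNW.ef1 hu).mul_RRSshare_le hn hu⟩
end

section
/- Let (X, 𝒮) be an X3C instance: X a set of 3q elements and 𝒮 = {S_1,…,S_n} a family of 3-element subsets of X. Partition X arbitrarily into q triples s^k = {s^k_1, s^k_2, s^k_3} for k ∈ {1,…,q}. Introduce 8q fresh vertices s^k_{i,j} (i ∈ {1,2}, j ∈ {1,2,3,4}), all distinct from each other and from X, and define for each k and each i ∈ {1,2} the 3-sets T^k_{i,1} = {s^k_{i,1}, s^k_{i,2}, s^k_{i,3}}, T^k_{i,2} = {s^k_{i,2}, s^k_{i,3}, s^k_{i,4}}, T^k_{i,3} = {s^k_{i,1}, s^k_{i,2}, s^k_{i,4}}, T^k_{i,4} = {s^k_{i,1}, s^k_{i,3}, s^k_1}, T^k_{i,5} = {s^k_{i,4}, s^k_2, s^k_3}. Let Y = X ∪ {s^k_{i,j}} (so |Y| = 11q) and 𝒯 = 𝒮 ∪ {T^k_{i,j} : i ∈ {1,2}, j ∈ {1,…,5}, k ∈ {1,…,q}}. Then the X33C instance (Y, 𝒯) has an exact triple-cover (a multiset of |Y| sets from 𝒯,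 repetition allowed, such that every vertex of Y lies in exactly three chosen sets counted with multiplicity) if and only if (X, 𝒮) has an exact cover (a subfamily of q sets from 𝒮 covering every element of X exactly once). -/
open Finset

namespace X33C

theorem countP_eq_sum_count {α : Type*} [DecidableEq α] (C : Multiset α) (s : Finset α)
    (h : ∀ a ∈ C, a ∈ s) (p : α → Prop) [DecidablePred p] :
    C.countP p = ∑ a ∈ s, if p a then C.count a else 0 := by
  rw [Multiset.countP_eq_card_filter,
    ← Multiset.sum_count_eq_card (s := s) fun a ha => h a (Multiset.mem_of_mem_filter ha)]
  exact Finset.sum_congr rfl fun a _ => Multiset.count_filter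

/-- The gadget triple `T^k_{i,j}` attached to `(k, i, j)`. -/
def gadget {q : ℕ} {X : Type} [DecidableEq X] (part : X ≃ Fin q × Fin 3)
    (a : Fin q × Fin 2 × Fin 5) : Finset (X ⊕ (Fin q × Fin 2 × Fin 4)) :=
  if a.2.2 = 0 then {.inr (a.1, a.2.1, 0), .inr (a.1, a.2.1, 1), .inr (a.1, a.2.1, 2)}
  else if a.2.2 = 1 then {.inr (a.1, a.2.1, 1), .inr (a.1, a.2.1, 2), .inr (a.1, a.2.1, 3)}
  else if a.2.2 = 2 then {.inr (a.1, a.2.1, 0), .inr (a.1, a.2.1, 1), .inr (a.1, a.2.1, 3)}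
  else if a.2.2 = 3 then
    {.inr (a.1, a.2.1, 0), .inr (a.1, a.2.1, 2), .inl (part.symm (a.1, 0))}
  else {.inr (a.1, a.2.1, 3), .inl (part.symm (a.1, 1)), .inl (part.symm (a.1, 2))}

/-- The fresh vertices contained in the `j`-th triple of a gadget. -/
def freshPart (j : Fin 5) : Finset (Fin 4) :=
  ![{0, 1, 2}, {1, 2, 3}, {0, 1, 3}, {0, 2}, {3}] j

/-- The original vertices contained in the `j`-th triple of a gadget. -/
def origPart (j : Fin 5) : Finset (Fin 3) :=
  ![∅, ∅, ∅, {0}, {1, 2}] j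

theorem freshPart_nonempty : ∀ j, (freshPart j).Nonempty := by decide

theorem sum_origPart : ∀ r : Fin 3, (∑ _i : Fin 2, ∑ j, if r ∈ origPart j then 1 else 0) = 2 := by
  decide

section

variable {q : ℕ} {X : Type} [DecidableEq X] (part : X ≃ Fin q × Fin 3)

theorem inr_mem_gadget (k k' : Fin q) (i i' : Fin 2) (l : Fin 4) (j : Fin 5) :
    Sum.inr (k', i', l) ∈ gadget part (k, i, j) ↔ k = k' ∧ i = i' ∧ l ∈ freshPart j := by
  fin_cases j <;> simp [gadget, freshPart] <;> grind

theorem inl_mem_gadget (k : Fin q) (i : Fin 2) (x : X) (j : Fin 5) :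
    Sum.inl x ∈ gadget part (k, i, j) ↔ k = (part x).1 ∧ (part x).2 ∈ origPart j := by
  fin_cases j <;> simp [gadget, origPart, Equiv.eq_symm_apply, Prod.ext_iff] <;> grind

theorem gadget_injective : Function.Injective (gadget part) := by
  rintro ⟨k, i, j⟩ ⟨k', i', j'⟩ h
  have key : ∀ l, l ∈ freshPart j ↔ k' = k ∧ i' = i ∧ l ∈ freshPart j' := fun l => by
    rw [← inr_mem_gadget part, ← h, inr_mem_gadget]; simp
  obtain ⟨l, hl⟩ : ∃ l, l ∈ freshPart j := freshPart_nonempty j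
  obtain ⟨rfl, rfl, -⟩ := (key l).1 hl
  have hinj : ∀ j j' : Fin 5, (∀ l, l ∈ freshPart j ↔ l ∈ freshPart j') → j = j' := by decide
  rw [hinj j j' fun l => by simpa using key l]

theorem gadget_ne_image_inl (a : Fin q × Fin 2 × Fin 5) (S : Finset X) :
    gadget part a ≠ S.image Sum.inl := by
  obtain ⟨k, i, j⟩ := a
  intro h
  obtain ⟨l, hl⟩ : ∃ l, l ∈ freshPart j := freshPart_nonempty j
  have := (inr_mem_gadget part k k i i l j).2 ⟨rfl, rfl, hl⟩
  simp [h] at this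

/-- The collection of all triples of the reduced instance. -/
def triples (𝒮 : Finset (Finset X)) : Finset (Finset (X ⊕ (Fin q × Fin 2 × Fin 4))) :=
  (𝒮.image fun S => S.image Sum.inl) ∪ Finset.univ.image (gadget part)

theorem sum_triples (𝒮 : Finset (Finset X))
    (f : Finset (X ⊕ (Fin q × Fin 2 × Fin 4)) → ℕ) :
    ∑ t ∈ triples part 𝒮, f t =
      ∑ S ∈ 𝒮, f (S.image Sum.inl) + ∑ a, f (gadget part a) := by
  rw [triples, Finset.sum_union, Finset.sum_image, Finset.sum_image]
  · exact (gadget_injective part).injOn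
  · exact (Finset.image_injective Sum.inl_injective).injOn
  · rw [Finset.disjoint_left]
    intro t ht ht'
    obtain ⟨S, -, rfl⟩ := Finset.mem_image.1 ht
    obtain ⟨a, -, ha⟩ := Finset.mem_image.1 ht'
    exact gadget_ne_image_inl part a S ha

variable {𝒮 : Finset (Finset X)} {C : Multiset (Finset (X ⊕ (Fin q × Fin 2 × Fin 4)))}

theorem countP_inr (hC : ∀ t ∈ C, t ∈ triples part 𝒮) (k : Fin q) (i : Fin 2) (l : Fin 4) :
    C.countP (fun t => Sum.inr (k, i, l) ∈ t) =
      ∑ j, if l ∈ freshPart j then C.count (gadget part (k, i, j)) else 0 := by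
  rw [countP_eq_sum_count C _ hC, sum_triples]
  simp [Fintype.sum_prod_type, inr_mem_gadget, ite_and, Finset.sum_ite_irrel]

theorem countP_inl (hC : ∀ t ∈ C, t ∈ triples part 𝒮) (x : X) :
    C.countP (fun t => Sum.inl x ∈ t) =
      (∑ S ∈ 𝒮, if x ∈ S then C.count (S.image Sum.inl) else 0) +
        ∑ i, ∑ j, if (part x).2 ∈ origPart j then
          C.count (gadget part ((part x).1, i, j)) else 0 := by
  rw [countP_eq_sum_count C _ hC, sum_triples]
  simp [Fintype.sum_prod_type, inl_mem_gadget, ite_and, Finset.sum_ite_irrel]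

theorem count_gadget_eq_one (hC : ∀ t ∈ C, t ∈ triples part 𝒮)
    (h3 : ∀ y, C.countP (fun t => y ∈ t) = 3) (a : Fin q × Fin 2 × Fin 5) :
    C.count (gadget part a) = 1 := by
  obtain ⟨k, i, j⟩ := a
  have hf : ∀ i l, (∑ j, if l ∈ freshPart j then C.count (gadget part (k, i, j)) else 0) = 3 :=
    fun i l => by rw [← countP_inr part hC, h3]
  have ho := countP_inl part hC (part.symm (k, 1))
  rw [h3] at ho
  have e0 := fun i => hf i 0
  have e1 := fun i => hf i 1
  have e2 := fun i => hf i 2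
  have e3 := fun i => hf i 3
  simp [Fin.sum_univ_succ, freshPart, Fin.forall_fin_two] at e0 e1 e2 e3
  simp [Fin.sum_univ_succ, origPart] at ho
  fin_cases i <;> fin_cases j <;> simp <;> omega

theorem sum_count_eq_one (hC : ∀ t ∈ C, t ∈ triples part 𝒮)
    (h3 : ∀ y, C.countP (fun t => y ∈ t) = 3) (x : X) :
    (∑ S ∈ 𝒮, if x ∈ S then C.count (S.image Sum.inl) else 0) = 1 := by
  have h := countP_inl part hC x
  simp only [h3, count_gadget_eq_one part hC h3] at h
  rw [sum_origPart] at h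
  omega

theorem exists_exactCover [Fintype X] (h𝒮 : ∀ S ∈ 𝒮, S.card = 3)
    (hC : ∀ t ∈ C, t ∈ triples part 𝒮) (h3 : ∀ y, C.countP (fun t => y ∈ t) = 3) :
    ∃ D : Finset (Finset X),
      D ⊆ 𝒮 ∧ D.card = q ∧ ∀ x : X, (D.filter fun S => x ∈ S).card = 1 := by
  have hcov : ∀ x : X,
      ((𝒮.filter fun S => S.image Sum.inl ∈ C).filter fun S => x ∈ S).card = 1 := by
    intro x
    have h1 := sum_count_eq_one part hC h3 x
    rw [Finset.filter_filter, Finset.card_filter]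
    refine Eq.trans (Finset.sum_congr rfl fun S hS => ?_) h1
    have hle := Finset.single_le_sum (s := 𝒮)
      (f := fun S => if x ∈ S then C.count (S.image Sum.inl) else 0)
      (fun _ _ => Nat.zero_le _) hS
    rw [h1] at hle
    have hpos := Multiset.count_pos (a := S.image Sum.inl) (s := C)
    by_cases hx : x ∈ S <;> by_cases hm : S.image Sum.inl ∈ C <;> simp [hx, hm] at hle hpos ⊢
    omega
  refine ⟨_, Finset.filter_subset _ _, ?_, hcov⟩
  have hs := Finset.sum_card hcov
  rw [Finset.sum_congr rfl fun S hS => h𝒮 S (Finset.mem_filter.1 hS).1] at hs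
  have hX := Fintype.card_congr part
  simp at hs hX
  omega

theorem exists_tripleCover {D : Finset (Finset X)} (hD : D ⊆ 𝒮) (hq : D.card = q)
    (hcov : ∀ x : X, (D.filter fun S => x ∈ S).card = 1) :
    ∃ C : Multiset (Finset (X ⊕ (Fin q × Fin 2 × Fin 4))),
      C.card = 11 * q ∧ (∀ t ∈ C, t ∈ triples part 𝒮) ∧
        ∀ y, C.countP (fun t => y ∈ t) = 3 := by
  have hmem : ∀ t ∈ (triples part D).val, t ∈ triples part D := fun _ ht => ht
  have hcount : ∀ t ∈ triples part D, (triples part D).val.count t = 1 :=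
    fun t ht => Multiset.count_eq_one_of_mem (triples part D).nodup ht
  have hg : ∀ a, (triples part D).val.count (gadget part a) = 1 := fun a =>
    hcount _ (Finset.mem_union_right _ (Finset.mem_image_of_mem _ (Finset.mem_univ a)))
  refine ⟨(triples part D).val, ?_, fun t ht => ?_, ?_⟩
  · rw [Finset.card_val, Finset.card_eq_sum_ones, sum_triples]
    simp [hq]
    omega
  · exact Finset.union_subset_union_left (Finset.image_subset_image hD) ht
  · rintro (x | ⟨k, i, l⟩)
    · rw [countP_inl part hmem]
      simp only [hg]
      have h1 := hcov x
      rw [Finset.card_filter] at h1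
      rw [sum_origPart, Finset.sum_congr rfl fun S hS => ?_, h1]
      rw [hcount _ (Finset.mem_union_left _ (Finset.mem_image_of_mem _ hS))]
    · rw [countP_inr part hmem]
      simp only [hg]
      revert l
      decide

end

end X33C

-- **Statement 14.** Reduction from X3C to X33C (Exact Triple-Cover by 3-sets).
-- `X` is a set of `3q` elements, partitioned (via `part`) into `q` triples
-- `s^k = {s^k_1, s^k_2, s^k_3}`; the fresh vertices `s^k_{i,j}` are modeled by the right
-- summand `Fin q × Fin 2 × Fin 4` of the vertex type `X ⊕ (Fin q × Fin 2 × Fin 4)`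
-- (so `|Y| = 3q + 8q = 11q`). The family `𝒯` consists of the image of `𝒮` under `Sum.inl`
-- together with the gadget sets `T^k_{i,1}, …, T^k_{i,5}`. Then `(Y, 𝒯)` has an exact
-- triple-cover (a multiset of `11q` sets from `𝒯` covering every vertex exactly three
-- times, with multiplicity) iff `(X, 𝒮)` has an exact cover (`q` sets from `𝒮` covering
-- every element of `X` exactly once).
theorem X33C_reduction (q : ℕ) (hq : 1 ≤ q) (X : Type) [Fintype X] [DecidableEq X]
    (part : X ≃ Fin q × Fin 3)
    (𝒮 : Finset (Finset X)) (h𝒮 : ∀ S ∈ 𝒮, S.card = 3) :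
    let V : Type := X ⊕ (Fin q × Fin 2 × Fin 4)
    let fresh : Fin q → Fin 2 → Fin 4 → V := fun k i j => Sum.inr (k, i, j)
    let orig : Fin q → Fin 3 → V := fun k j => Sum.inl (part.symm (k, j))
    let T : Fin q → Fin 2 → Fin 5 → Finset V := fun k i j =>
      if j = 0 then {fresh k i 0, fresh k i 1, fresh k i 2}
      else if j = 1 then {fresh k i 1, fresh k i 2, fresh k i 3}
      else if j = 2 then {fresh k i 0, fresh k i 1, fresh k i 3}
      else if j = 3 then {fresh k i 0, fresh k i 2, orig k 0}
      else {fresh k i 3, orig k 1, orig k 2}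
    let 𝒯 : Finset (Finset V) :=
      (𝒮.image fun S => S.image Sum.inl) ∪
        (Finset.univ.image fun kij : Fin q × Fin 2 × Fin 5 => T kij.1 kij.2.1 kij.2.2)
    ((∃ C : Multiset (Finset V),
        C.card = 11 * q ∧ (∀ Ts ∈ C, Ts ∈ 𝒯) ∧
        ∀ y : V, C.countP (fun Ts => y ∈ Ts) = 3) ↔
      (∃ C : Finset (Finset X),
        C ⊆ 𝒮 ∧ C.card = q ∧ ∀ x : X, (C.filter fun S => x ∈ S).card = 1)) := by
  intro V fresh orig T 𝒯
  have h𝒯 : 𝒯 = X33C.triples part 𝒮 := rfl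
  clear_value 𝒯
  subst h𝒯
  constructor
  · rintro ⟨C, -, hC, h3⟩
    exact X33C.exists_exactCover part h𝒮 hC h3
  · rintro ⟨D, hD, hq', hcov⟩
    exact X33C.exists_tripleCover part hD hq' hcov
end

section
/- Let (Y, 𝒯) be an X33C instance with |Y| = r and 𝒯 = {T_1,…,T_s} a collection of 3-element subsets of Y, and fix ε with 0 < ε < 1/(3r). Construct a public decision making instance with r players (one per vertex v ∈ Y) and r issues, where each issue has r + s alternatives: for each player i an alternative a_{t,i} valued 1 − ε by player i and 0 by all others, and for each set T_j ∈ 𝒯 an alternative valued 1/3 by each player i ∈ T_j and 0 by all others. Then (Y, 𝒯) has an exact triple-cover if and only if every outcome of this instance satisfying both PPS and Pareto optimality gives every player utility exactly 1. (In this instance PPS_i = 1 − ε for every player i.) -/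
open Finset

namespace PubInst

variable {n m : ℕ}

/-- Every outcome is weakly dominated by a Pareto optimal one. -/
theorem exists_paretoOptimal_ge (I : PubInst n m) (c₀ : I.Outcome) :
    ∃ c : I.Outcome, (∀ i, I.util c₀ i ≤ I.util c i) ∧ I.ParetoOptimal c := by
  classical
  have := I.fin
  have : Finite I.Outcome := inferInstanceAs (Finite ((t : Fin m) → I.A t))
  obtain ⟨c, hc, hmax⟩ := (Set.toFinite
    {c : I.Outcome | ∀ i, I.util c₀ i ≤ I.util c i}).exists_maximalFor (fun c => ∑ i, I.util c i) _ ⟨c₀, fun i => le_rfl⟩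
  refine ⟨c, hc, ?_⟩
  rintro ⟨c', hge, j, hj⟩
  have hlt : ∑ i, I.util c i < ∑ i, I.util c' i :=
    Finset.sum_lt_sum (fun i _ => hge i) ⟨j, Finset.mem_univ j, hj⟩
  exact absurd (hmax (fun i => (hc i).trans (hge i)) hlt.le) (not_le.mpr hlt)

/-- With as many issues as players, if player `i` has the same maximum utility on every issue,
then that maximum is the pessimistic proportional share. -/
theorem PPS_eq_of_umax_const (I : PubInst n n) (hn : 1 ≤ n) {i : Fin n} {b : ℝ}
    (h : ∀ t, I.umax i t = b) : I.PPS i = b := by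
  have hfun : I.umax i = fun _ => b := funext h
  have hdiv : n / n = 1 := Nat.div_self hn
  unfold PPS sortedDesc
  rw [hfun, hdiv, Finset.sum_eq_single (⟨n - 1, by omega⟩ : Fin n)]
  · simp
  · intro k _ hk
    have : k.val ≠ n - 1 := fun h' => hk (Fin.ext h')
    have := k.isLt
    rw [if_neg (by omega)]
  · simp

end PubInst

section TripleCover

variable {r s : ℕ} (𝒯 : Fin s → Finset (Fin r)) (ε : ℝ)

/-- The value to player `i` of an alternative of the triple-cover instance: `inl i` is worth
`1 - ε` and `inr j` is worth `1 / 3` when `i ∈ 𝒯 j`. -/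
noncomputable def coverValue (i : Fin r) (a : Fin r ⊕ Fin s) : ℝ :=
  Sum.elim (fun i' => if i' = i then 1 - ε else 0) (fun j => if i ∈ 𝒯 j then 1 / 3 else 0) a

theorem coverValue_le {ε : ℝ} (hε : ε ≤ 1 / 3) (i : Fin r) (a : Fin r ⊕ Fin s) :
    coverValue 𝒯 ε i a ≤ 1 - ε := by
  rcases a with i' | j <;> simp only [coverValue, Sum.elim_inl, Sum.elim_inr] <;> split_ifs <;>
    linarith

theorem sum_coverValue {𝒯 : Fin s → Finset (Fin r)} (h𝒯 : ∀ j, (𝒯 j).card = 3)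
    (a : Fin r ⊕ Fin s) :
    ∑ i, coverValue 𝒯 ε i a = if a.isLeft then 1 - ε else 1 := by
  rcases a with i' | j
  · simp [coverValue]
  · simp [coverValue, h𝒯 j]

theorem exists_sum_coverValue_eq {ι : Type*} (S : Finset ι) (c : ι → Fin r ⊕ Fin s)
    (i : Fin r) :
    ∃ k l : ℕ, ∑ t ∈ S, coverValue 𝒯 ε i (c t) = k * (1 - ε) + l / 3 := by
  classical
  induction S using Finset.induction_on with
  | empty => exact ⟨0, 0, by simp⟩
  | insert t S ht ih =>
    obtain ⟨k, l, h⟩ := ih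
    rw [Finset.sum_insert ht, h]
    rcases c t with i' | j <;> simp only [coverValue, Sum.elim_inl, Sum.elim_inr] <;> split_ifs
    · exact ⟨k + 1, l, by push_cast; ring⟩
    · exact ⟨k, l, by ring⟩
    · exact ⟨k, l + 1, by push_cast; ring⟩
    · exact ⟨k, l, by ring⟩

/-- No achievable utility lies strictly between `1` and `4 / 3 - ε`. -/
theorem four_thirds_sub_le_of_one_lt {ε : ℝ} (hε : 0 < ε) (hε' : ε ≤ 1 / 3) (k l : ℕ)
    (h : 1 < (k : ℝ) * (1 - ε) + l / 3) : 4 / 3 - ε ≤ (k : ℝ) * (1 - ε) + l / 3 := by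
  have hl : (0 : ℝ) ≤ l := l.cast_nonneg
  rcases k with _ | _ | k
  · have : 3 < l := by
      have : (3 : ℝ) < l := by norm_num at h; linarith
      exact_mod_cast this
    have : (4 : ℝ) ≤ l := by exact_mod_cast this
    norm_num
    linarith
  · have : 0 < l := by
      have : (0 : ℝ) < l := by norm_num at h; linarith
      exact_mod_cast this
    have : (1 : ℝ) ≤ l := by exact_mod_cast this
    norm_num
    linarith
  · have hk : (0 : ℝ) ≤ k := k.cast_nonneg
    push_cast
    nlinarith

/-- If every player gets at least `1 - ε`, then no player gets more than `1`. -/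
theorem sum_coverValue_le_one {𝒯 : Fin s → Finset (Fin r)} (h𝒯 : ∀ j, (𝒯 j).card = 3)
    {ε : ℝ} (hε : 0 < ε) (hε' : ε < 1 / (3 * r)) (c : Fin r → Fin r ⊕ Fin s)
    (hc : ∀ i, 1 - ε ≤ ∑ t, coverValue 𝒯 ε i (c t)) (i : Fin r) :
    ∑ t, coverValue 𝒯 ε i (c t) ≤ 1 := by
  by_contra! hlt
  have hr : (1 : ℝ) ≤ r := by exact_mod_cast i.pos
  have hrε : r * ε < 1 / 3 := by
    rw [lt_div_iff₀ (by positivity)] at hε'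
    linarith
  have hε3 : ε ≤ 1 / 3 := by nlinarith
  obtain ⟨k, l, hkl⟩ := exists_sum_coverValue_eq 𝒯 ε univ c i
  have hi : 4 / 3 - ε ≤ ∑ t, coverValue 𝒯 ε i (c t) := by
    rw [hkl] at hlt ⊢
    exact four_thirds_sub_le_of_one_lt hε hε3 k l hlt
  have hupper : ∑ i, ∑ t, coverValue 𝒯 ε i (c t) ≤ r := by
    rw [Finset.sum_comm]
    calc ∑ t, ∑ i, coverValue 𝒯 ε i (c t) ≤ ∑ _t : Fin r, (1 : ℝ) := by
          refine Finset.sum_le_sum fun t _ => ?_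
          rw [sum_coverValue ε h𝒯]
          split_ifs <;> linarith
      _ = r := by simp
  have hlower : ∑ i' : Fin r, ((1 - ε) + if i' = i then (1 / 3 : ℝ) else 0) ≤
      ∑ i', ∑ t, coverValue 𝒯 ε i' (c t) := by
    refine Finset.sum_le_sum fun i' _ => ?_
    split_ifs with h
    · subst h
      linarith
    · linarith [hc i']
  rw [Finset.sum_add_distrib, Finset.sum_ite_eq' univ i] at hlower
  simp only [sum_const, card_univ, Fintype.card_fin, nsmul_eq_mul, mem_univ, if_true] at hlower
  linarith

/-- If every player gets exactly `1`, then every chosen alternative is a set. -/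
theorem exists_eq_inr_of_sum_coverValue_eq_one {𝒯 : Fin s → Finset (Fin r)}
    (h𝒯 : ∀ j, (𝒯 j).card = 3) {ε : ℝ} (hε : 0 < ε) (c : Fin r → Fin r ⊕ Fin s)
    (hc : ∀ i, ∑ t, coverValue 𝒯 ε i (c t) = 1) (t : Fin r) : ∃ j, c t = Sum.inr j := by
  rcases hct : c t with i' | j
  · have hlt : ∑ t, ∑ i, coverValue 𝒯 ε i (c t) < ∑ _t : Fin r, (1 : ℝ) := by
      refine Finset.sum_lt_sum (fun t _ => ?_) ⟨t, mem_univ t, ?_⟩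
      · rw [sum_coverValue ε h𝒯]
        split_ifs <;> linarith
      · rw [sum_coverValue ε h𝒯, hct]
        simpa using hε
    rw [Finset.sum_comm] at hlt
    simp [hc] at hlt
  · exact ⟨j, rfl⟩

theorem sum_coverValue_inr (d : Fin r → Fin s) (i : Fin r) :
    ∑ t, coverValue 𝒯 ε i (Sum.inr (d t)) =
      (((univ.val.map d).map 𝒯).countP (fun Ts => i ∈ Ts) : ℕ) / 3 := by
  simp only [coverValue, Sum.elim_inr]
  rw [Multiset.map_map, Multiset.countP_map, ← Finset.sum_filter, Finset.sum_const, nsmul_eq_mul]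
  simp [Finset.card_def, div_eq_mul_inv]

end TripleCover

/-- Reduction from X33C to finding a PPS + Pareto optimal outcome.
Given an X33C instance with vertex set `Fin r` and 3-sets `𝒯 j ⊆ Fin r` for `j : Fin s`,
and `0 < ε < 1/(3r)`, build the public decision instance with `r` players and `r` issues
where every issue has alternatives `Fin r ⊕ Fin s`: alternative `inl i'` is worth `1 - ε`
to player `i'` and `0` to everyone else, and alternative `inr j` is worth `1/3` to each
player in `𝒯 j` and `0` to everyone else (in this instance `PPS_i = 1 - ε` for all `i`).
Then `(Fin r, 𝒯)` has an exact triple-cover iff every outcome satisfying PPS and Pareto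
optimality gives every player utility exactly `1`. -/
theorem X33C_iff_PPS_PO_utility_one (r s : ℕ) (hr : 1 ≤ r)
    (𝒯 : Fin s → Finset (Fin r)) (h𝒯 : ∀ j, (𝒯 j).card = 3)
    (ε : ℝ) (hε : 0 < ε) (hε' : ε < 1 / (3 * r)) :
    let I : PubInst r r :=
      { A := fun _ => Fin r ⊕ Fin s
        fin := fun _ => inferInstance
        nonempty := fun _ => ⟨Sum.inl ⟨0, hr⟩⟩
        u := fun i _ a =>
          Sum.elim (fun i' => if i' = i then 1 - ε else 0)
            (fun j => if i ∈ 𝒯 j then 1 / 3 else 0) a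
        nonneg := by
          intro i t a
          rcases a with i' | j <;> simp only [Sum.elim_inl, Sum.elim_inr] <;> split <;>
            try norm_num
          have h3 : (1 : ℝ) / (3 * r) ≤ 1 := by
            rw [div_le_one (by positivity)]
            have : (1 : ℝ) ≤ (r : ℝ) := by exact_mod_cast hr
            nlinarith
          linarith }
    ((∃ C : Multiset (Fin s),
        C.card = r ∧ ∀ v : Fin r, (C.map 𝒯).countP (fun Ts => v ∈ Ts) = 3) ↔
      (∀ c : I.Outcome, (∀ i, I.PPS i ≤ I.util c i) → I.ParetoOptimal c →
        ∀ i, I.util c i = 1)) := by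
  intro I
  have hr1 : (1 : ℝ) ≤ r := by exact_mod_cast hr
  have hε3 : ε ≤ 1 / 3 := hε'.le.trans (one_div_le_one_div_of_le (by norm_num) (by linarith))
  have hutil : ∀ (c : I.Outcome) i, I.util c i = ∑ t, coverValue 𝒯 ε i (c t) :=
    fun _ _ => rfl
  have hPPS : ∀ i, I.PPS i = 1 - ε := by
    refine fun i => I.PPS_eq_of_umax_const hr fun t => le_antisymm ?_ ?_
    · exact Finset.sup'_le _ _ fun a _ => coverValue_le 𝒯 hε3 i a
    · let := I.fin t
      have hi : I.u i t (Sum.inl i : Fin r ⊕ Fin s) = 1 - ε := if_pos rfl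
      exact hi.symm.le.trans
        (Finset.le_sup' (I.u i t) (mem_univ (Sum.inl i : Fin r ⊕ Fin s)))
  constructor
  · rintro ⟨C, hcard, hC⟩ c hc hPO
    obtain ⟨d, rfl⟩ : ∃ d : Fin r → Fin s, univ.val.map d = C := by
      subst hcard
      obtain ⟨L, rfl⟩ := Quot.exists_rep C
      exact ⟨L.get, (Fin.univ_val_map L.get).trans (congrArg _ (List.ofFn_get L))⟩
    have hle : ∀ i, I.util c i ≤ 1 :=
      sum_coverValue_le_one h𝒯 hε hε' c fun i => (hPPS i).symm.le.trans (hc i)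
    let c' : I.Outcome := fun t => (Sum.inr (d t) : Fin r ⊕ Fin s)
    have hc' : ∀ i, I.util c' i = 1 := by
      intro i
      refine (sum_coverValue_inr 𝒯 ε d i).trans ?_
      rw [hC i]
      norm_num
    intro i
    by_contra hne
    exact hPO ⟨c', fun i => (hle i).trans_eq (hc' i).symm, i,
      ((hle i).lt_of_ne hne).trans_eq (hc' i).symm⟩
  · intro h
    let c₀ : I.Outcome := fun t => (Sum.inl t : Fin r ⊕ Fin s)
    have hc₀ : ∀ i, I.util c₀ i = 1 - ε := by
      intro i
      rw [hutil]
      simp [c₀, coverValue]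
    obtain ⟨c, hge, hPO⟩ := I.exists_paretoOptimal_ge c₀
    have hone := h c (fun i => ((hPPS i).trans (hc₀ i).symm).le.trans (hge i)) hPO
    choose d hd using exists_eq_inr_of_sum_coverValue_eq_one h𝒯 hε c hone
    refine ⟨univ.val.map d, by simp, fun v => ?_⟩
    have hv : I.util c v = _ :=
      (Finset.sum_congr rfl fun t _ => by rw [hd t]; rfl).trans (sum_coverValue_inr 𝒯 ε d v)
    rw [hone v, eq_div_iff (by norm_num), one_mul] at hv
    exact_mod_cast hv.symm
end

section
/- Let n ≥ 1 and m ≤ 4n − 2. Then in every private goods division instance with n players and m goods, every allocation A satisfying RRS (u_i(A_i) ≥ RRS_i for all players i) also satisfies Prop1: for every player i, either u_i(A_i) ≥ Prop_i, or there exists a good g ∉ A_i with u_i(A_i ∪ {g}) ≥ Prop_i. -/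
open Finset

/-- A nonnegative non-increasing sequence bounded by `x`, summed over its first `4n - 2` terms,
is controlled by its terms of (1-indexed) rank `n`, `2n` and `3n`. -/
theorem sum_range_le_of_antitone {W : ℕ → ℝ} (hW : Antitone W) {x : ℝ} (hx : ∀ r, W r ≤ x)
    (k : ℕ) :
    ∑ r ∈ range (4 * k + 2), W r ≤
      k * x + (k + 1) * W k + (k + 1) * W (2 * k + 1) + k * W (3 * k + 2) := by
  have block (a l : ℕ) : ∑ r ∈ range l, W (a + r) ≤ l * W a := by
    have h := sum_le_card_nsmul (range l) (fun r => W (a + r)) (W a)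
      (fun r _ => hW (Nat.le_add_right a r))
    simpa using h
  have hfirst : ∑ r ∈ range k, W r ≤ k * x := by
    have h := sum_le_card_nsmul (range k) W x (fun r _ => hx r)
    simpa using h
  rw [show 4 * k + 2 = k + (k + 1) + (k + 1) + k by ring, sum_range_add, sum_range_add,
    sum_range_add]
  have h1 := block k (k + 1)
  have h2 := block (k + (k + 1)) (k + 1)
  have h3 := block (k + (k + 1) + (k + 1)) k
  rw [show k + (k + 1) = 2 * k + 1 by ring] at *
  rw [show 2 * k + 1 + (k + 1) = 3 * k + 2 by ring] at *
  push_cast at h1 h2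
  linarith

/-- Extension of a function on `Fin m` to `ℕ` by zero. -/
noncomputable def extendZero {m : ℕ} (w : Fin m → ℝ) (r : ℕ) : ℝ :=
  if h : r < m then w ⟨r, h⟩ else 0

theorem extendZero_val {m : ℕ} (w : Fin m → ℝ) (r : Fin m) : extendZero w r = w r := by
  simp [extendZero]

theorem extendZero_nonneg {m : ℕ} {w : Fin m → ℝ} (hw : ∀ r, 0 ≤ w r) (r : ℕ) :
    0 ≤ extendZero w r := by
  unfold extendZero
  split_ifs
  exacts [hw _, le_rfl]

theorem extendZero_mono {m : ℕ} {v w : Fin m → ℝ} (h : ∀ r, v r ≤ w r) (r : ℕ) :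
    extendZero v r ≤ extendZero w r := by
  unfold extendZero
  split_ifs
  exacts [h _, le_rfl]

theorem extendZero_antitone {m : ℕ} {w : Fin m → ℝ} (hw : ∀ r, 0 ≤ w r) (ha : Antitone w) :
    Antitone (extendZero w) := by
  intro a b hab
  by_cases hb : b < m
  · simpa [extendZero, hb, hab.trans_lt hb] using
      ha (show (⟨a, hab.trans_lt hb⟩ : Fin m) ≤ ⟨b, hb⟩ from hab)
  · simpa [extendZero, hb] using extendZero_nonneg hw a

theorem sum_eq_sum_range_extendZero {m N : ℕ} (hN : m ≤ N) (w : Fin m → ℝ) :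
    ∑ r, w r = ∑ r ∈ range N, extendZero w r := by
  rw [← sum_subset (range_mono hN), ← Fin.sum_univ_eq_sum_range]
  · simp [extendZero_val]
  · intro r _ hr
    simp_all [extendZero]

/-- The round robin share dominates the values of (1-indexed) rank `n`, `2n` and `3n`. -/
theorem le_RRSshare {k m : ℕ} (hm : m ≤ 4 * k + 2) (u : Fin (k + 1) → Fin m → ℝ)
    (hu : ∀ i g, 0 ≤ u i g) (i : Fin (k + 1)) :
    extendZero (sortedDesc (u i)) k + extendZero (sortedDesc (u i)) (2 * k + 1) +
      extendZero (sortedDesc (u i)) (3 * k + 2) ≤ RRSshare u i := by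
  set V := extendZero (sortedDesc (u i))
  have hV : ∀ r, 0 ≤ V r := extendZero_nonneg fun r => hu i _
  have hR : RRSshare u i =
      ∑ r ∈ range (4 * k + 3), if (k + 1) ∣ (r + 1) then V r else 0 := by
    rw [RRSshare, sum_eq_sum_range_extendZero (show m ≤ 4 * k + 3 by omega)]
    refine sum_congr rfl fun r _ => ?_
    by_cases hr : r < m
    · have hle : (k + 1) ∣ (r + 1) → r + 1 ≤ (m / (k + 1)) * (k + 1) := by
        rintro ⟨c, hc⟩
        rw [hc, mul_comm]
        refine Nat.mul_le_mul_right _ ((Nat.le_div_iff_mul_le (Nat.succ_pos k)).2 ?_)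
        rw [mul_comm, ← hc]
        exact hr
      by_cases hd : (k + 1) ∣ (r + 1)
      · simp [V, extendZero, hr, hd, hle hd]
      · simp [extendZero, hd]
    · simp [V, extendZero, hr]
  have hd1 : (k + 1) ∣ (2 * k + 1 + 1) := ⟨2, by ring⟩
  have hd2 : (k + 1) ∣ (3 * k + 2 + 1) := ⟨3, by ring⟩
  have hsub : ({k, 2 * k + 1, 3 * k + 2} : Finset ℕ) ⊆ range (4 * k + 3) := by
    intro r hr
    simp only [mem_insert, mem_singleton] at hr
    simp only [mem_range]
    omega
  rw [hR]
  refine le_trans (le_of_eq ?_) (sum_le_sum_of_subset_of_nonneg hsub fun r _ _ => ?_)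
  · rw [sum_insert, sum_insert, sum_singleton, if_pos dvd_rfl, if_pos hd1, if_pos hd2]
    · ring
    · simp only [mem_singleton]; omega
    · simp only [mem_insert, mem_singleton]; omega
  · split_ifs
    exacts [hV r, le_rfl]

/-- For private goods division with `m ≤ 4n - 2` goods, every allocation
satisfying RRS also satisfies Prop1 (proportionality up to one good). -/
theorem RRS_implies_Prop1_of_few_goods {n m : ℕ} (hn : 1 ≤ n) (hm : m ≤ 4 * n - 2)
    (u : Fin n → Fin m → ℝ) (hu : ∀ i g, 0 ≤ u i g) (A : Fin m → Fin n)
    (hRRS : ∀ i : Fin n, RRSshare u i ≤ bundleVal u A i i) :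
    Prop1alloc u A := by
  obtain ⟨k, rfl⟩ : ∃ k, n = k + 1 := ⟨n - 1, by omega⟩
  replace hm : m ≤ 4 * k + 2 := by omega
  intro i
  have hk : (0 : ℝ) ≤ k := k.cast_nonneg
  have hn0 : (0 : ℝ) < ((k + 1 : ℕ) : ℝ) := by positivity
  by_cases hall : ∀ g, A g = i
  · left
    have hV : 0 ≤ ∑ g, u i g := sum_nonneg fun g _ => hu i g
    rw [propShare, div_le_iff₀ hn0]
    simp only [bundleVal, hall, if_true]
    push_cast
    nlinarith
  · right
    push Not at hall
    obtain ⟨g0, hg0, hmax⟩ := exists_max_image (univ.filter fun g => A g ≠ i) (u i)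
      (by simpa [Finset.Nonempty] using hall)
    simp only [mem_filter, mem_univ, true_and] at hg0 hmax
    refine ⟨g0, hg0, ?_⟩
    set x := u i g0
    have hx : 0 ≤ x := hu i g0
    set b := bundleVal u A i i with hb
    set E := ∑ g, (u i g - min (u i g) x) with hE
    have hmin : ∀ g, 0 ≤ min (u i g) x := fun g => le_min (hu i g) hx
    -- the values truncated at `x`, in non-increasing order
    let w : Fin m → ℝ := fun r => min (sortedDesc (u i) r) x
    have hw : ∀ r, 0 ≤ w r := fun r => hmin _
    have hWanti : Antitone (extendZero w) := extendZero_antitone hw fun a c hac =>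
      min_le_min_right x (sortedDesc_antitone (u i) hac)
    have hWnonneg := extendZero_nonneg hw
    have hWx : ∀ r, extendZero w r ≤ x := by
      intro r
      unfold extendZero
      split_ifs
      exacts [min_le_right _ _, hx]
    have hWV := extendZero_mono (v := w) (w := sortedDesc (u i)) fun r => min_le_left _ _
    have hbR := (le_RRSshare hm u hu i).trans (hRRS i)
    rw [← hb] at hbR
    have hsum : ∑ g, u i g = E + ∑ r ∈ range (4 * k + 2), extendZero w r := by
      have hperm : ∑ r, w r = ∑ g, min (u i g) x :=
        Equiv.sum_comp (Tuple.sort fun j => -u i j) fun g => min (u i g) x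
      rw [← sum_eq_sum_range_extendZero hm, hperm, hE, ← sum_add_distrib]
      simp
    have hblocks := sum_range_le_of_antitone hWanti hWx k
    have h1 := hWV k
    have h2 := hWV (2 * k + 1)
    have h3 := hWV (3 * k + 2)
    have h4 := hWnonneg (3 * k + 2)
    have h5 := hWx k
    have h6 := hWx (2 * k + 1)
    have hkb := mul_le_mul_of_nonneg_left
      (show extendZero w k + extendZero w (2 * k + 1) + extendZero w (3 * k + 2) ≤ b by linarith)
      hk
    rw [propShare, div_le_iff₀ hn0, hsum]
    push_cast
    by_cases hbig : ∃ g1, x < u i g1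
    · obtain ⟨g1, hg1⟩ := hbig
      have hbE : E + x ≤ b := by
        have hsplit : E + x = ∑ g, (u i g - min (u i g) x + if g = g1 then x else 0) := by
          rw [sum_add_distrib, sum_ite_eq' univ g1, if_pos (mem_univ _)]
        rw [hsplit, hb, bundleVal]
        refine sum_le_sum fun g _ => ?_
        by_cases hg : A g = i
        · have := hmin g
          rw [if_pos hg]
          split_ifs with h
          · subst h
            rw [min_eq_right hg1.le]
            linarith
          · linarith
        · have hgx := hmax g hg
          have hne : g ≠ g1 := by
            rintro rfl
            exact absurd hgx (not_le.2 hg1)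
          simp [hg, hne, min_eq_left hgx]
      linarith
    · push Not at hbig
      have hE0 : E = 0 := sum_eq_zero fun g _ => by rw [min_eq_left (hbig g), sub_self]
      linarith
end

section
/- For every n ≥ 2 and every m > 4n − 2 there exists a private goods division instance with n players and m goods, and an allocation A, such that A satisfies RRS (u_i(A_i) ≥ RRS_i for all players i) but violates Prop1: for some player i, u_i(A_i) < Prop_i and u_i(A_i ∪ {g}) < Prop_i for every good g ∉ A_i. Hence for private goods RRS implies Prop1 if and only if m ≤ 4n − 2. -/
open Finset

/-- One good of value `3`, followed by `4n - 2` goods of value `1` and worthless goods. -/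
def oneBigGood (n m : ℕ) (g : Fin m) : ℝ :=
  if g.val = 0 then 3 else if g.val < 4 * n - 1 then 1 else 0

lemma oneBigGood_antitone (n m : ℕ) : Antitone (oneBigGood n m) := by
  intro a b hab
  have h : a.val ≤ b.val := hab
  unfold oneBigGood
  split_ifs <;> first | omega | norm_num

lemma card_multiples_lt_le_three {n m : ℕ} (hn : 2 ≤ n) :
    (univ.filter fun r : Fin m => n ∣ r.val + 1 ∧ r.val < 4 * n - 1).card ≤ 3 := by
  have h : (univ.filter fun r : Fin m => n ∣ r.val + 1 ∧ r.val < 4 * n - 1).card ≤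
      (Icc 1 3).card := by
    refine card_le_card_of_injOn (fun r => (r.val + 1) / n) ?_ ?_
    · intro r hr
      obtain ⟨⟨k, hk⟩, hlt⟩ : n ∣ r.val + 1 ∧ r.val < 4 * n - 1 := by simpa using hr
      have hdiv : (r.val + 1) / n = k := by rw [hk, Nat.mul_div_cancel_left _ (by omega)]
      have hpos : 1 ≤ k := Nat.one_le_iff_ne_zero.2 (by rintro rfl; omega)
      have hle : k < 4 := by
        by_contra! hge
        have := Nat.mul_le_mul_left n hge
        omega
      simp only [coe_Icc, Set.mem_Icc, hdiv]
      omega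
    · intro r hr s hs hrs
      have hr' : n ∣ r.val + 1 ∧ r.val < 4 * n - 1 := by simpa using hr
      have hs' : n ∣ s.val + 1 ∧ s.val < 4 * n - 1 := by simpa using hs
      have := (Nat.div_left_inj hr'.1 hs'.1).1 hrs
      exact Fin.ext (by omega)
  simpa using h

lemma RRSshare_le_three {n m : ℕ} (hn : 2 ≤ n) {u : Fin n → Fin m → ℝ} {i : Fin n}
    (hu : u i = oneBigGood n m) : RRSshare u i ≤ 3 := by
  calc RRSshare u i
      ≤ ∑ r : Fin m, if n ∣ r.val + 1 ∧ r.val < 4 * n - 1 then (1 : ℝ) else 0 := by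
        rw [RRSshare, hu, sortedDesc_of_antitone (oneBigGood_antitone n m)]
        refine sum_le_sum fun r _ => ?_
        by_cases hd : n ∣ r.val + 1
        · have h0 : r.val ≠ 0 := by
            intro h0
            have := Nat.le_of_dvd (by omega) hd
            omega
          simp only [hd, true_and, oneBigGood, h0, if_false]
          split_ifs <;> norm_num
        · simp [hd]
    _ = ((univ.filter fun r : Fin m => n ∣ r.val + 1 ∧ r.val < 4 * n - 1).card : ℝ) := by
        simp
    _ ≤ 3 := by exact_mod_cast card_multiples_lt_le_three hn

lemma sum_oneBigGood {n m : ℕ} (hn : 2 ≤ n) (hm : 4 * n - 2 < m) :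
    ∑ g : Fin m, oneBigGood n m g = 4 * n + 1 := by
  have hsplit : ∀ g : Fin m, oneBigGood n m g =
      (if g.val < 4 * n - 1 then (1 : ℝ) else 0) + if g = ⟨0, by omega⟩ then 2 else 0 := by
    intro g
    simp only [oneBigGood, Fin.ext_iff]
    split_ifs <;> first | omega | norm_num
  simp only [hsplit, sum_add_distrib, sum_ite_eq', mem_univ, if_true, sum_boole,
    Fin.card_filter_val_lt]
  rw [min_eq_right (by omega), Nat.cast_sub (by omega)]
  push_cast
  ring

/-- For every `n ≥ 2` and `m > 4n - 2` there is a private goods division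
instance with `n` players and `m` goods, and an allocation satisfying RRS that violates
Prop1: some player `i` falls short of her proportional share even after adding any single
good outside her bundle. Hence, for private goods, RRS implies Prop1 only if `m ≤ 4n - 2`. -/
theorem RRS_not_implies_Prop1_of_many_goods (n m : ℕ) (hn : 2 ≤ n) (hm : 4 * n - 2 < m) :
    ∃ (u : Fin n → Fin m → ℝ) (A : Fin m → Fin n),
      (∀ i g, 0 ≤ u i g) ∧
      (∀ i : Fin n, RRSshare u i ≤ bundleVal u A i i) ∧
      ∃ i : Fin n,
        bundleVal u A i i < propShare u i ∧
        ∀ g : Fin m, A g ≠ i → bundleVal u A i i + u i g < propShare u i := by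
  let a : Fin n := ⟨0, by omega⟩
  let b : Fin n := ⟨1, by omega⟩
  have hba : b ≠ a := by simp [a, b]
  let u : Fin n → Fin m → ℝ := fun i => if i = a then oneBigGood n m else 0
  let A : Fin m → Fin n := fun g => if g.val = 0 then a else b
  have hua : u a = oneBigGood n m := if_pos rfl
  have hA : ∀ g, A g = a ↔ g = ⟨0, by omega⟩ := by
    intro g
    by_cases hg : g.val = 0 <;> simp [A, hg, hba, Fin.ext_iff]
  have hval : bundleVal u A a a = 3 := by
    simp [bundleVal, hA, hua, oneBigGood]
  have hn0 : (0 : ℝ) < n := by exact_mod_cast (by omega : 0 < n)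
  have hprop : 4 < propShare u a := by
    rw [propShare, hua, sum_oneBigGood hn hm, lt_div_iff₀ hn0]
    linarith
  refine ⟨u, A, ?_, ?_, a, by linarith, ?_⟩
  · intro i g
    by_cases hi : i = a
    · simp only [u, hi, if_true, oneBigGood]
      split_ifs <;> norm_num
    · simp [u, hi]
  · intro i
    by_cases hi : i = a
    · rw [hi, hval]
      exact RRSshare_le_three hn hua
    · simp [RRSshare, bundleVal, sortedDesc, u, hi]
  · intro g hg
    have hg0 : g.val ≠ 0 := fun h => hg ((hA g).2 (Fin.ext h))
    have hle : u a g ≤ 1 := by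
      simp only [hua, oneBigGood, hg0, if_false]
      split_ifs <;> norm_num
    linarith
end
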